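/- For every integer n ≥ 2, every integer k ≥ 2 and every exponent 1 < p ≤ 2 there exist ε₀ > 0 and R₀ > 0, depending only on n, k, p, with the following property: let u : ℝⁿ × [0,∞) → ℝ^k be a continuous map into the unit sphere S^{k−1} (|u| ≡ 1) which is smooth on ℝⁿ × (0,∞) and solves the harmonic map heat flow ∂_t u = Δu + |∇u|² u there, which satisfies ∫₀^∞ ∫_{ℝⁿ} (|∇u|² + |∂_t u|²) < ∞, and which satisfies ‖∇u‖_{M^{p,p}_{R₀}} + ‖∂_t u‖_{M^{p,2p}_{R₀}} ≤ ε₀. Then there exists a smooth harmonic map u_∞ : ℝⁿ → S^{k−1} (i.e. |u_∞| ≡ 1 and Δu_∞ + |∇u_∞|² u_∞ = 0) with ∫_{ℝⁿ} |∇u_∞|² < ∞ such that lim_{t→∞} ∫_{ℝⁿ} |∇(u(·,t) − u_∞)|² = 0, and for every compact set K ⊂ ℝⁿ and every integer m ≥ 0, u(·,t) together with its derivatives up to order m converges to u_∞ uniformly on K as t → ∞. -/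

import Mathlib

open MeasureTheory Metric Set Filter Real

noncomputable section

abbrev Sp (n : ℕ) := EuclideanSpace ℝ (Fin n)

/-- The `α`-th spatial coordinate direction in spacetime `ℝⁿ × ℝ`. -/
def sdir (n : ℕ) (α : Fin n) : Sp n × ℝ := (EuclideanSpace.single α 1, 0)

/-- The time direction in spacetime `ℝⁿ × ℝ`. -/
def tdir (n : ℕ) : Sp n × ℝ := (0, 1)

/-- Directional derivative of the `i`-th component of `u` in direction `v`. -/
def pd {n k : ℕ} (u : Sp n × ℝ → Fin k → ℝ) (i : Fin k) (v : Sp n × ℝ) (z : Sp n × ℝ) : ℝ :=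
  fderiv ℝ (fun w => u w i) z v

/-- Squared spatial gradient `|∇u|²`. -/
def gradSq {n k : ℕ} (u : Sp n × ℝ → Fin k → ℝ) (z : Sp n × ℝ) : ℝ :=
  ∑ α : Fin n, ∑ i : Fin k, (pd u i (sdir n α) z) ^ 2

/-- Squared time derivative `|∂ₜu|²`. -/
def dtSq {n k : ℕ} (u : Sp n × ℝ → Fin k → ℝ) (z : Sp n × ℝ) : ℝ :=
  ∑ i : Fin k, (pd u i (tdir n) z) ^ 2

/-- Spatial Laplacian `Δuⁱ`. -/
def lap {n k : ℕ} (u : Sp n × ℝ → Fin k → ℝ) (i : Fin k) (z : Sp n × ℝ) : ℝ :=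
  ∑ α : Fin n, fderiv ℝ (pd u i (sdir n α)) z (sdir n α)

/-- `u` takes values in the unit sphere `S^{k-1}` on `D`. -/
def SphereValued {n k : ℕ} (u : Sp n × ℝ → Fin k → ℝ) (D : Set (Sp n × ℝ)) : Prop :=
  ∀ z ∈ D, ∑ i : Fin k, (u z i) ^ 2 = 1

/-- `u` solves the harmonic map heat flow `∂ₜu = Δu + |∇u|² u` into the sphere on `D`. -/
def HeatFlow {n k : ℕ} (u : Sp n × ℝ → Fin k → ℝ) (D : Set (Sp n × ℝ)) : Prop :=
  ∀ z ∈ D, ∀ i : Fin k, pd u i (tdir n) z = lap u i z + gradSq u z * u z i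

/-- Parabolic cylinder `P_r(z₀) = closedBall(x₀,r) × (t₀ - r², t₀]`. -/
def pcyl {n : ℕ} (z₀ : Sp n × ℝ) (r : ℝ) : Set (Sp n × ℝ) :=
  closedBall z₀.1 r ×ˢ Ioc (z₀.2 - r ^ 2) z₀.2

/-- Spatial directional derivative of the `i`-th component of a map on `ℝⁿ`. -/
def spd {n k : ℕ} (v : Sp n → Fin k → ℝ) (i : Fin k) (α : Fin n) (x : Sp n) : ℝ :=
  fderiv ℝ (fun y => v y i) x (EuclideanSpace.single α 1)

/-- Squared gradient `|∇v|²` of a map on `ℝⁿ`. -/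
def gradSqSp {n k : ℕ} (v : Sp n → Fin k → ℝ) (x : Sp n) : ℝ :=
  ∑ α : Fin n, ∑ i : Fin k, (spd v i α x) ^ 2

/-- Laplacian `Δvⁱ` of a map on `ℝⁿ`. -/
def lapSp {n k : ℕ} (v : Sp n → Fin k → ℝ) (i : Fin k) (x : Sp n) : ℝ :=
  ∑ α : Fin n, fderiv ℝ (spd v i α) x (EuclideanSpace.single α 1)

/-- The restricted parabolic Morrey smallness condition on `ℝⁿ × (0,∞)`. -/
def MorreySmall {n k : ℕ} (u : Sp n × ℝ → Fin k → ℝ) (p R₀ ε : ℝ) : Prop :=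
  ∃ A B : ℝ, A + B ≤ ε ∧
    (∀ (x : Sp n) (t r : ℝ), 0 < t → 0 < r → r < min R₀ (Real.sqrt t) →
      (r ^ (p - n - 2) * ∫ w in pcyl (x, t) r, (gradSq u w) ^ (p / 2)) ^ (1 / p) ≤ A) ∧
    (∀ (x : Sp n) (t r : ℝ), 0 < t → 0 < r → r < min R₀ (Real.sqrt t) →
      (r ^ (2 * p - n - 2) * ∫ w in pcyl (x, t) r, (dtSq u w) ^ (p / 2)) ^ (1 / p) ≤ B)

open scoped ContDiff in
/-- Smoothness on the open upper half of spacetime. -/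
def SmoothPos {n : ℕ} (f : Sp n × ℝ → ℝ) : Prop := ContDiffOn ℝ ∞ f {z : Sp n × ℝ | 0 < z.2}

/-- Directional derivative of a scalar function on spacetime. -/
def dirDeriv {n : ℕ} (v : Sp n × ℝ) (f : Sp n × ℝ → ℝ) (z : Sp n × ℝ) : ℝ := fderiv ℝ f z v

/-- The heat operator `∂ₜ - Δ`. -/
def heatOp {n : ℕ} (f : Sp n × ℝ → ℝ) (z : Sp n × ℝ) : ℝ :=
  dirDeriv (tdir n) f z - ∑ α : Fin n, dirDeriv (sdir n α) (dirDeriv (sdir n α) f) z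

section Calculus

variable {n : ℕ} {f g : Sp n × ℝ → ℝ} {z v w : Sp n × ℝ}

theorem isOpen_pos : IsOpen {z : Sp n × ℝ | 0 < z.2} :=
  isOpen_lt continuous_const continuous_snd

theorem pos_mem_nhds (hz : 0 < z.2) : {z : Sp n × ℝ | 0 < z.2} ∈ nhds z :=
  isOpen_pos.mem_nhds hz

namespace SmoothPos

open scoped ContDiff in
theorem contDiffAt (hf : SmoothPos f) (hz : 0 < z.2) : ContDiffAt ℝ ∞ f z :=
  ContDiffOn.contDiffAt hf (pos_mem_nhds hz)

theorem differentiableAt (hf : SmoothPos f) (hz : 0 < z.2) : DifferentiableAt ℝ f z :=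
  (hf.contDiffAt hz).differentiableAt (by simp)

theorem continuousOn (hf : SmoothPos f) : ContinuousOn f {z : Sp n × ℝ | 0 < z.2} :=
  ContDiffOn.continuousOn hf

theorem dirDeriv (hf : SmoothPos f) (v : Sp n × ℝ) : SmoothPos (dirDeriv v f) :=
  (ContDiffOn.fderiv_of_isOpen hf isOpen_pos (by simp)).clm_apply contDiffOn_const

theorem add (hf : SmoothPos f) (hg : SmoothPos g) : SmoothPos (fun z => f z + g z) :=
  ContDiffOn.add hf hg

theorem sub (hf : SmoothPos f) (hg : SmoothPos g) : SmoothPos (fun z => f z - g z) :=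
  ContDiffOn.sub hf hg

theorem mul (hf : SmoothPos f) (hg : SmoothPos g) : SmoothPos (fun z => f z * g z) :=
  ContDiffOn.mul hf hg

theorem sum {ι : Type*} {s : Finset ι} {F : ι → Sp n × ℝ → ℝ} (hF : ∀ i ∈ s, SmoothPos (F i)) :
    SmoothPos (fun z => ∑ i ∈ s, F i z) :=
  ContDiffOn.sum hF

theorem const (c : ℝ) : SmoothPos (fun _ : Sp n × ℝ => c) := contDiffOn_const

end SmoothPos

theorem dirDeriv_congr (h : ∀ z : Sp n × ℝ, 0 < z.2 → f z = g z) (hz : 0 < z.2) :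
    dirDeriv v f z = dirDeriv v g z := by
  have : f =ᶠ[nhds z] g := by
    filter_upwards [pos_mem_nhds hz] with y hy using h y hy
  rw [dirDeriv, dirDeriv, this.fderiv_eq]

theorem dirDeriv_add (hf : SmoothPos f) (hg : SmoothPos g) (hz : 0 < z.2) :
    dirDeriv v (fun z => f z + g z) z = dirDeriv v f z + dirDeriv v g z := by
  simp [dirDeriv, fderiv_fun_add (hf.differentiableAt hz) (hg.differentiableAt hz)]

theorem dirDeriv_sub (hf : SmoothPos f) (hg : SmoothPos g) (hz : 0 < z.2) :
    dirDeriv v (fun z => f z - g z) z = dirDeriv v f z - dirDeriv v g z := by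
  simp [dirDeriv, fderiv_fun_sub (hf.differentiableAt hz) (hg.differentiableAt hz)]

theorem dirDeriv_mul (hf : SmoothPos f) (hg : SmoothPos g) (hz : 0 < z.2) :
    dirDeriv v (fun z => f z * g z) z = f z * dirDeriv v g z + dirDeriv v f z * g z := by
  simp [dirDeriv, fderiv_fun_mul (hf.differentiableAt hz) (hg.differentiableAt hz), mul_comm]

theorem dirDeriv_const_mul (c : ℝ) (hf : SmoothPos f) (hz : 0 < z.2) :
    dirDeriv v (fun z => c * f z) z = c * dirDeriv v f z := by
  simp [dirDeriv, fderiv_const_mul (hf.differentiableAt hz)]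

theorem dirDeriv_sum {ι : Type*} {s : Finset ι} {F : ι → Sp n × ℝ → ℝ}
    (hF : ∀ i ∈ s, SmoothPos (F i)) (hz : 0 < z.2) :
    dirDeriv v (fun z => ∑ i ∈ s, F i z) z = ∑ i ∈ s, dirDeriv v (F i) z := by
  simp [dirDeriv, fderiv_fun_sum fun i hi => (hF i hi).differentiableAt hz]

theorem dirDeriv_comm (hf : SmoothPos f) (hz : 0 < z.2) :
    dirDeriv v (dirDeriv w f) z = dirDeriv w (dirDeriv v f) z := by
  have h2 : ContDiffAt ℝ 2 f z :=
    (hf.contDiffAt hz).of_le (WithTop.coe_le_coe.2 (le_top : (2 : ℕ∞) ≤ ⊤))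
  have hd : DifferentiableAt ℝ (fderiv ℝ f) z :=
    (h2.fderiv_right (m := 1) (by norm_num)).differentiableAt (by simp)
  have key : ∀ a b : Sp n × ℝ, dirDeriv a (dirDeriv b f) z = fderiv ℝ (fderiv ℝ f) z a b := by
    intro a b
    have : dirDeriv b f = fun y => fderiv ℝ f y b := rfl
    rw [dirDeriv, this, fderiv_clm_apply hd (differentiableAt_const b)]
    simp
  rw [key, key]
  exact (h2.isSymmSndFDerivAt (by simp)) v w

theorem heatOp_add (hf : SmoothPos f) (hg : SmoothPos g) (hz : 0 < z.2) :
    heatOp (fun z => f z + g z) z = heatOp f z + heatOp g z := by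
  have h : ∀ α, dirDeriv (sdir n α) (dirDeriv (sdir n α) fun z => f z + g z) z
      = dirDeriv (sdir n α) (dirDeriv (sdir n α) f) z
        + dirDeriv (sdir n α) (dirDeriv (sdir n α) g) z := fun α => by
    rw [dirDeriv_congr (fun y hy => dirDeriv_add hf hg hy) hz,
      dirDeriv_add (hf.dirDeriv _) (hg.dirDeriv _) hz]
  simp only [heatOp, h, dirDeriv_add hf hg hz, Finset.sum_add_distrib]
  ring

theorem heatOp_const_mul (c : ℝ) (hf : SmoothPos f) (hz : 0 < z.2) :
    heatOp (fun z => c * f z) z = c * heatOp f z := by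
  have h : ∀ α, dirDeriv (sdir n α) (dirDeriv (sdir n α) fun z => c * f z) z
      = c * dirDeriv (sdir n α) (dirDeriv (sdir n α) f) z := fun α => by
    rw [dirDeriv_congr (fun y hy => dirDeriv_const_mul c hf hy) hz,
      dirDeriv_const_mul c (hf.dirDeriv _) hz]
  simp only [heatOp, h, dirDeriv_const_mul c hf hz, ← Finset.mul_sum]
  ring

theorem heatOp_sum {ι : Type*} {s : Finset ι} {F : ι → Sp n × ℝ → ℝ}
    (hF : ∀ i ∈ s, SmoothPos (F i)) (hz : 0 < z.2) :
    heatOp (fun z => ∑ i ∈ s, F i z) z = ∑ i ∈ s, heatOp (F i) z := by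
  have h : ∀ α, dirDeriv (sdir n α) (dirDeriv (sdir n α) fun z => ∑ i ∈ s, F i z) z
      = ∑ i ∈ s, dirDeriv (sdir n α) (dirDeriv (sdir n α) (F i)) z := fun α => by
    rw [dirDeriv_congr (fun y hy => dirDeriv_sum hF hy) hz,
      dirDeriv_sum (fun i hi => (hF i hi).dirDeriv _) hz]
  simp only [heatOp, h, dirDeriv_sum hF hz, Finset.sum_sub_distrib]
  rw [Finset.sum_comm]

theorem heatOp_mul (hf : SmoothPos f) (hg : SmoothPos g) (hz : 0 < z.2) :
    heatOp (fun z => f z * g z) z = f z * heatOp g z + heatOp f z * g z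
      - 2 * ∑ α : Fin n, dirDeriv (sdir n α) f z * dirDeriv (sdir n α) g z := by
  have h : ∀ α, dirDeriv (sdir n α) (dirDeriv (sdir n α) fun z => f z * g z) z
      = f z * dirDeriv (sdir n α) (dirDeriv (sdir n α) g) z
        + dirDeriv (sdir n α) (dirDeriv (sdir n α) f) z * g z
        + 2 * (dirDeriv (sdir n α) f z * dirDeriv (sdir n α) g z) := fun α => by
    rw [dirDeriv_congr (fun y hy => dirDeriv_mul hf hg hy) hz,
      dirDeriv_add (hf.mul (hg.dirDeriv _)) ((hf.dirDeriv _).mul hg) hz,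
      dirDeriv_mul hf (hg.dirDeriv _) hz, dirDeriv_mul (hf.dirDeriv _) hg hz]
    ring
  simp only [heatOp, h, dirDeriv_mul hf hg hz, Finset.sum_add_distrib, ← Finset.mul_sum,
    ← Finset.sum_mul]
  ring

theorem heatOp_dirDeriv (hf : SmoothPos f) (hz : 0 < z.2) :
    heatOp (dirDeriv v f) z = dirDeriv v (heatOp f) z := by
  have h : ∀ α, dirDeriv (sdir n α) (dirDeriv (sdir n α) (dirDeriv v f)) z
      = dirDeriv v (dirDeriv (sdir n α) (dirDeriv (sdir n α) f)) z := fun α => by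
    rw [dirDeriv_congr (fun y hy => dirDeriv_comm hf hy) hz, dirDeriv_comm (hf.dirDeriv _) hz]
  change _ = dirDeriv v (fun y => dirDeriv (tdir n) f y
    - ∑ α : Fin n, dirDeriv (sdir n α) (dirDeriv (sdir n α) f) y) z
  rw [dirDeriv_sub (hf.dirDeriv _) (SmoothPos.sum fun _ _ => (hf.dirDeriv _).dirDeriv _) hz,
    dirDeriv_sum (fun _ _ => (hf.dirDeriv _).dirDeriv _) hz, heatOp, dirDeriv_comm hf hz]
  simp only [h]

end Calculus

/-- Contraction of the `m`-th spatial derivatives of `f` and `g`. -/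
def jetInner {n : ℕ} : ℕ → (Sp n × ℝ → ℝ) → (Sp n × ℝ → ℝ) → Sp n × ℝ → ℝ
  | 0, f, g, z => f z * g z
  | m + 1, f, g, z => ∑ α : Fin n, jetInner m (dirDeriv (sdir n α) f) (dirDeriv (sdir n α) g) z

/-- Sum of the absolute values of all `m`-th spatial derivatives of `f`. -/
def jetNorm {n : ℕ} : ℕ → (Sp n × ℝ → ℝ) → Sp n × ℝ → ℝ
  | 0, f, z => |f z|
  | m + 1, f, z => ∑ α : Fin n, jetNorm m (dirDeriv (sdir n α) f) z

section Jets

variable {n : ℕ} {f g : Sp n × ℝ → ℝ} {z : Sp n × ℝ}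

theorem SmoothPos.jetInner {m : ℕ} :
    ∀ {f g : Sp n × ℝ → ℝ}, SmoothPos f → SmoothPos g → SmoothPos (jetInner m f g) := by
  induction m with
  | zero => exact fun hf hg => hf.mul hg
  | succ m ih => exact fun hf hg => SmoothPos.sum fun α _ => ih (hf.dirDeriv _) (hg.dirDeriv _)

theorem jetInner_self_nonneg (m : ℕ) : ∀ f : Sp n × ℝ → ℝ, 0 ≤ jetInner m f f z := by
  induction m with
  | zero => exact fun f => mul_self_nonneg _
  | succ m ih => exact fun f => Finset.sum_nonneg fun α _ => ih _

theorem jetNorm_nonneg (m : ℕ) : ∀ f : Sp n × ℝ → ℝ, 0 ≤ jetNorm m f z := by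
  induction m with
  | zero => exact fun f => abs_nonneg _
  | succ m ih => exact fun f => Finset.sum_nonneg fun α _ => ih _

theorem jetInner_congr (m : ℕ) : ∀ {f f' g g' : Sp n × ℝ → ℝ},
    (∀ z : Sp n × ℝ, 0 < z.2 → f z = f' z) → (∀ z : Sp n × ℝ, 0 < z.2 → g z = g' z) →
    0 < z.2 → jetInner m f g z = jetInner m f' g' z := by
  induction m with
  | zero => intro f f' g g' hf hg hz; simp only [jetInner, hf z hz, hg z hz]
  | succ m ih =>
    intro f f' g g' hf hg hz
    exact Finset.sum_congr rfl fun α _ =>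
      ih (fun y hy => dirDeriv_congr hf hy) (fun y hy => dirDeriv_congr hg hy) hz

theorem jetNorm_congr (m : ℕ) : ∀ {f f' : Sp n × ℝ → ℝ},
    (∀ z : Sp n × ℝ, 0 < z.2 → f z = f' z) → 0 < z.2 → jetNorm m f z = jetNorm m f' z := by
  induction m with
  | zero => intro f f' hf hz; simp only [jetNorm, hf z hz]
  | succ m ih =>
    intro f f' hf hz
    exact Finset.sum_congr rfl fun α _ => ih (fun y hy => dirDeriv_congr hf hy) hz

theorem jetInner_sq_le (m : ℕ) : ∀ f g : Sp n × ℝ → ℝ,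
    jetInner m f g z ^ 2 ≤ jetInner m f f z * jetInner m g g z := by
  induction m with
  | zero => intro f g; simp only [jetInner]; exact le_of_eq (by ring)
  | succ m ih =>
    intro f g
    exact Finset.sum_sq_le_sum_mul_sum_of_sq_le_mul _ (fun α _ => jetInner_self_nonneg m _)
      (fun α _ => jetInner_self_nonneg m _) fun α _ => ih _ _

theorem abs_jetInner_le (m : ℕ) : ∀ f g : Sp n × ℝ → ℝ,
    |jetInner m f g z| ≤ jetNorm m f z * jetNorm m g z := by
  induction m with
  | zero => intro f g; simp [jetInner, jetNorm, abs_mul]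
  | succ m ih =>
    intro f g
    calc |jetInner (m + 1) f g z|
        ≤ ∑ α : Fin n, |jetInner m (dirDeriv (sdir n α) f) (dirDeriv (sdir n α) g) z| :=
          Finset.abs_sum_le_sum_abs _ _
      _ ≤ ∑ α : Fin n, jetNorm m (dirDeriv (sdir n α) f) z
            * jetNorm (m + 1) g z := by
          refine Finset.sum_le_sum fun α _ => (ih _ _).trans ?_
          refine mul_le_mul_of_nonneg_left ?_ (jetNorm_nonneg m _)
          exact Finset.single_le_sum (f := fun β => jetNorm m (dirDeriv (sdir n β) g) z)
            (fun β _ => jetNorm_nonneg m _) (Finset.mem_univ α)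
      _ = jetNorm (m + 1) f z * jetNorm (m + 1) g z := by
          rw [← Finset.sum_mul]; rfl

theorem jetNorm_sq_le (m : ℕ) : ∀ f : Sp n × ℝ → ℝ,
    jetNorm m f z ^ 2 ≤ (n : ℝ) ^ m * jetInner m f f z := by
  induction m with
  | zero => intro f; simp [jetInner, jetNorm, sq]
  | succ m ih =>
    intro f
    calc jetNorm (m + 1) f z ^ 2
        ≤ n * ∑ α : Fin n, jetNorm m (dirDeriv (sdir n α) f) z ^ 2 := by
          simpa [jetNorm] using sq_sum_le_card_mul_sum_sq (s := Finset.univ)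
            (f := fun α : Fin n => jetNorm m (dirDeriv (sdir n α) f) z)
      _ ≤ n * ∑ α : Fin n, (n : ℝ) ^ m
            * jetInner m (dirDeriv (sdir n α) f) (dirDeriv (sdir n α) f) z := by
          gcongr with α; exact ih _
      _ = _ := by rw [← Finset.mul_sum, pow_succ']; simp only [jetInner]; ring

theorem dirDeriv_jetInner_self {v : Sp n × ℝ} (m : ℕ) : ∀ {f : Sp n × ℝ → ℝ}, SmoothPos f →
    0 < z.2 → dirDeriv v (jetInner m f f) z = 2 * jetInner m f (dirDeriv v f) z := by
  induction m with
  | zero =>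
    intro f hf hz
    change dirDeriv v (fun y => f y * f y) z = _
    rw [dirDeriv_mul hf hf hz, jetInner]; ring
  | succ m ih =>
    intro f hf hz
    change dirDeriv v (fun y => ∑ α : Fin n,
      jetInner m (dirDeriv (sdir n α) f) (dirDeriv (sdir n α) f) y) z = _
    rw [dirDeriv_sum (fun α _ => (hf.dirDeriv _).jetInner (hf.dirDeriv _)) hz, jetInner,
      Finset.mul_sum]
    refine Finset.sum_congr rfl fun α _ => ?_
    rw [ih (hf.dirDeriv _) hz, jetInner_congr m (fun _ _ => rfl)
      (fun y hy => dirDeriv_comm hf hy) hz]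

theorem heatOp_jetInner_self (m : ℕ) : ∀ {f : Sp n × ℝ → ℝ}, SmoothPos f → 0 < z.2 →
    heatOp (jetInner m f f) z = 2 * jetInner m f (heatOp f) z - 2 * jetInner (m + 1) f f z := by
  induction m with
  | zero =>
    intro f hf hz
    change heatOp (fun y => f y * f y) z = _
    rw [heatOp_mul hf hf hz]; simp only [jetInner]; ring
  | succ m ih =>
    intro f hf hz
    change heatOp (fun y => ∑ α : Fin n,
      jetInner m (dirDeriv (sdir n α) f) (dirDeriv (sdir n α) f) y) z = _
    rw [heatOp_sum (fun α _ => (hf.dirDeriv _).jetInner (hf.dirDeriv _)) hz]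
    rw [jetInner, jetInner, Finset.mul_sum, Finset.mul_sum, ← Finset.sum_sub_distrib]
    refine Finset.sum_congr rfl fun α _ => ?_
    rw [ih (hf.dirDeriv _) hz, jetInner_congr m (fun _ _ => rfl)
      (fun y hy => heatOp_dirDeriv hf hy) hz]

theorem jetNorm_add_le (m : ℕ) : ∀ {f g : Sp n × ℝ → ℝ}, SmoothPos f → SmoothPos g → 0 < z.2 →
    jetNorm m (fun y => f y + g y) z ≤ jetNorm m f z + jetNorm m g z := by
  induction m with
  | zero => intro f g _ _ _; exact abs_add_le _ _
  | succ m ih =>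
    intro f g hf hg hz
    simp only [jetNorm]
    rw [← Finset.sum_add_distrib]
    refine Finset.sum_le_sum fun α _ => ?_
    rw [jetNorm_congr m (fun y hy => dirDeriv_add hf hg hy) hz]
    exact ih (hf.dirDeriv _) (hg.dirDeriv _) hz

theorem jetNorm_const_zero (m : ℕ) : jetNorm m (fun _ : Sp n × ℝ => (0 : ℝ)) z = 0 := by
  induction m with
  | zero => simp [jetNorm]
  | succ m ih =>
    have : ∀ v : Sp n × ℝ, dirDeriv v (fun _ : Sp n × ℝ => (0 : ℝ)) = fun _ => 0 := fun v => by
      funext y; simp [dirDeriv]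
    simp [jetNorm, this, ih]

theorem jetNorm_sum_le {ι : Type*} (s : Finset ι) (m : ℕ) {F : ι → Sp n × ℝ → ℝ}
    (hF : ∀ i ∈ s, SmoothPos (F i)) (hz : 0 < z.2) :
    jetNorm m (fun y => ∑ i ∈ s, F i y) z ≤ ∑ i ∈ s, jetNorm m (F i) z := by
  classical
  induction s using Finset.induction_on with
  | empty => simp [jetNorm_const_zero]
  | insert i s hi ih =>
    simp only [Finset.sum_insert hi]
    refine (jetNorm_add_le m (hF i (Finset.mem_insert_self i s)) (SmoothPos.sum fun j hj =>
      hF j (Finset.mem_insert_of_mem hj)) hz).trans ?_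
    gcongr
    exact ih fun j hj => hF j (Finset.mem_insert_of_mem hj)

/-- Leibniz estimate for the spatial derivatives of a product. -/
theorem jetNorm_mul_le (m : ℕ) : ∀ {f g : Sp n × ℝ → ℝ}, SmoothPos f → SmoothPos g → 0 < z.2 →
    jetNorm m (fun y => f y * g y) z
      ≤ 2 ^ m * ∑ p ∈ Finset.HasAntidiagonal.antidiagonal m, jetNorm p.1 f z * jetNorm p.2 g z := by
  induction m with
  | zero => intro f g _ _ _; simp [jetNorm, abs_mul]
  | succ m ih =>
    intro f g hf hg hz
    have h1 : jetNorm (m + 1) (fun y => f y * g y) z ≤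
        ∑ α : Fin n, (2 ^ m * ∑ p ∈ Finset.HasAntidiagonal.antidiagonal m,
            jetNorm p.1 f z * jetNorm p.2 (dirDeriv (sdir n α) g) z
          + 2 ^ m * ∑ p ∈ Finset.HasAntidiagonal.antidiagonal m,
            jetNorm p.1 (dirDeriv (sdir n α) f) z * jetNorm p.2 g z) := by
      refine Finset.sum_le_sum fun α _ => ?_
      rw [jetNorm_congr m (fun y hy => dirDeriv_mul hf hg hy) hz]
      refine (jetNorm_add_le m (hf.mul (hg.dirDeriv _)) ((hf.dirDeriv _).mul hg) hz).trans ?_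
      exact add_le_add (ih hf (hg.dirDeriv _) hz) (ih (hf.dirDeriv _) hg hz)
    have h2 : ∑ α : Fin n, (2 ^ m * ∑ p ∈ Finset.HasAntidiagonal.antidiagonal m,
            jetNorm p.1 f z * jetNorm p.2 (dirDeriv (sdir n α) g) z
          + 2 ^ m * ∑ p ∈ Finset.HasAntidiagonal.antidiagonal m,
            jetNorm p.1 (dirDeriv (sdir n α) f) z * jetNorm p.2 g z)
        = 2 ^ m * ∑ p ∈ Finset.HasAntidiagonal.antidiagonal m, jetNorm p.1 f z * jetNorm (p.2 + 1) g z
          + 2 ^ m * ∑ p ∈ Finset.HasAntidiagonal.antidiagonal m, jetNorm (p.1 + 1) f z * jetNorm p.2 g z := by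
      rw [Finset.sum_add_distrib, ← Finset.mul_sum, ← Finset.mul_sum, Finset.sum_comm,
        Finset.sum_comm (s := Finset.univ) (t := Finset.HasAntidiagonal.antidiagonal m)]
      simp only [jetNorm, Finset.mul_sum, Finset.sum_mul]
    have h3 : ∑ p ∈ Finset.HasAntidiagonal.antidiagonal m, jetNorm p.1 f z * jetNorm (p.2 + 1) g z
        ≤ ∑ p ∈ Finset.HasAntidiagonal.antidiagonal (m + 1), jetNorm p.1 f z * jetNorm p.2 g z := by
      rw [Finset.Nat.sum_antidiagonal_succ']
      exact le_add_of_nonneg_left (mul_nonneg (jetNorm_nonneg _ _) (jetNorm_nonneg _ _))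
    have h4 : ∑ p ∈ Finset.HasAntidiagonal.antidiagonal m, jetNorm (p.1 + 1) f z * jetNorm p.2 g z
        ≤ ∑ p ∈ Finset.HasAntidiagonal.antidiagonal (m + 1), jetNorm p.1 f z * jetNorm p.2 g z := by
      rw [Finset.Nat.sum_antidiagonal_succ]
      exact le_add_of_nonneg_left (mul_nonneg (jetNorm_nonneg _ _) (jetNorm_nonneg _ _))
    calc _ ≤ _ := h1.trans_eq h2
      _ ≤ 2 ^ m * ∑ p ∈ Finset.HasAntidiagonal.antidiagonal (m + 1), jetNorm p.1 f z * jetNorm p.2 g z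
          + 2 ^ m * ∑ p ∈ Finset.HasAntidiagonal.antidiagonal (m + 1), jetNorm p.1 f z * jetNorm p.2 g z := by
          gcongr
      _ = _ := by ring

end Jets

section MaximumPrinciple

variable {n : ℕ} {f g h : Sp n × ℝ → ℝ} {z : Sp n × ℝ}

theorem SmoothPos.snd : SmoothPos (fun z : Sp n × ℝ => z.2) := contDiffOn_snd

theorem SmoothPos.coord (α : Fin n) : SmoothPos (fun z : Sp n × ℝ => z.1 α) :=
  ContDiff.contDiffOn (by fun_prop)

theorem dirDeriv_snd (v : Sp n × ℝ) : dirDeriv v (fun z : Sp n × ℝ => z.2) z = v.2 := by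
  simp [dirDeriv, fderiv_snd]

theorem dirDeriv_coord (α : Fin n) (v : Sp n × ℝ) :
    dirDeriv v (fun z : Sp n × ℝ => z.1 α) z = v.1 α := by
  have h : HasFDerivAt (fun z : Sp n × ℝ => z.1 α)
      ((EuclideanSpace.proj (𝕜 := ℝ) α).comp (ContinuousLinearMap.fst ℝ (Sp n) ℝ)) z :=
    ((EuclideanSpace.proj (𝕜 := ℝ) α).comp (ContinuousLinearMap.fst ℝ (Sp n) ℝ)).hasFDerivAt
  rw [dirDeriv, h.fderiv]; rfl

theorem dirDeriv_const (c : ℝ) (v : Sp n × ℝ) : dirDeriv v (fun _ => c) z = 0 := by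
  simp [dirDeriv]

theorem heatOp_const (c : ℝ) : heatOp (fun _ : Sp n × ℝ => c) z = 0 := by
  have : ∀ v : Sp n × ℝ, dirDeriv v (fun _ : Sp n × ℝ => c) = fun _ => 0 := fun v => by
    funext y; exact dirDeriv_const c v
  simp [heatOp, this, dirDeriv_const]

theorem heatOp_snd : heatOp (fun z : Sp n × ℝ => z.2) z = 1 := by
  have : ∀ v : Sp n × ℝ, dirDeriv v (fun z : Sp n × ℝ => z.2) = fun _ => v.2 := fun v => by
    funext y; exact dirDeriv_snd v
  simp [heatOp, this, dirDeriv_const, tdir]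

theorem dirDeriv_dirDeriv_nonpos_of_isLocalMax (hf : SmoothPos f) (hz : 0 < z.2)
    {v : Sp n × ℝ} (hmax : IsLocalMax (fun τ : ℝ => f (z + τ • v)) 0) :
    dirDeriv v (dirDeriv v f) z ≤ 0 := by
  have hline : ∀ (F : Sp n × ℝ → ℝ), SmoothPos F → ∀ τ : ℝ, 0 < (z + τ • v).2 →
      HasDerivAt (fun τ : ℝ => F (z + τ • v)) (dirDeriv v F (z + τ • v)) τ := by
    intro F hF τ hτ
    have h1 : HasDerivAt (fun τ : ℝ => z + τ • v) v τ := by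
      simpa using ((hasDerivAt_id τ).smul_const v).const_add z
    exact (hF.differentiableAt hτ).hasFDerivAt.comp_hasDerivAt τ h1
  have hcont : Continuous (fun τ : ℝ => (z + τ • v).2) := by fun_prop
  have hev : ∀ᶠ τ : ℝ in nhds 0, 0 < (z + τ • v).2 :=
    hcont.continuousAt.eventually (lt_mem_nhds (by simpa using hz))
  have hderiv : deriv (fun τ : ℝ => f (z + τ • v)) =ᶠ[nhds 0]
      fun τ => dirDeriv v f (z + τ • v) := by
    filter_upwards [hev] with τ hτ using (hline f hf τ hτ).deriv
  have h2 : deriv (deriv fun τ : ℝ => f (z + τ • v)) 0 = dirDeriv v (dirDeriv v f) z := by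
    rw [hderiv.deriv_eq, (hline _ (hf.dirDeriv v) 0 hev.self_of_nhds).deriv]
    simp
  rw [← h2]
  by_contra hpos
  push Not at hpos
  have hmin : IsLocalMin (fun τ : ℝ => f (z + τ • v)) 0 :=
    isLocalMin_of_deriv_deriv_pos hpos hmax.deriv_eq_zero
      (hline f hf 0 hev.self_of_nhds).continuousAt
  have hconst : (fun τ : ℝ => f (z + τ • v)) =ᶠ[nhds 0] fun _ => f (z + (0 : ℝ) • v) := by
    filter_upwards [hmin, hmax] with τ h1 h2 using le_antisymm h2 h1
  have := hconst.deriv.deriv_eq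
  simp at this
  simp [this] at hpos

/-- Weak maximum principle on a parabolic cylinder. -/
theorem le_of_heatOp_le (hf : SmoothPos f) {x₀ : Sp n} {r t₁ t₀ B M : ℝ} (ht₁ : 0 < t₁)
    (hB : 0 ≤ B)
    (hint : ∀ z : Sp n × ℝ, dist z.1 x₀ < r → t₁ < z.2 → z.2 ≤ t₀ → heatOp f z ≤ B)
    (hlat : ∀ z : Sp n × ℝ, dist z.1 x₀ = r → t₁ ≤ z.2 → z.2 ≤ t₀ → f z ≤ M)
    (hbot : ∀ x : Sp n, dist x x₀ ≤ r → f (x, t₁) ≤ M)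
    (hz : dist z.1 x₀ ≤ r) (hz₁ : t₁ ≤ z.2) (hz₀ : z.2 ≤ t₀) :
    f z ≤ M + B * (z.2 - t₁) := by
  have main : ∀ ε : ℝ, 0 < ε → f z ≤ M + (B + ε) * (z.2 - t₁) := by
    intro ε hε
    set K : Set (Sp n × ℝ) := closedBall x₀ r ×ˢ Icc t₁ t₀ with hK
    have hKc : IsCompact K := (isCompact_closedBall _ _).prod isCompact_Icc
    have hKpos : ∀ y ∈ K, 0 < y.2 := fun y hy => ht₁.trans_le hy.2.1
    have haff : SmoothPos (fun y : Sp n × ℝ => -(B + ε) * (y.2 - t₁)) :=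
      (SmoothPos.const _).mul (SmoothPos.snd.sub (SmoothPos.const _))
    set W : Sp n × ℝ → ℝ := fun y => f y + -(B + ε) * (y.2 - t₁) with hW
    have hWs : SmoothPos W := hf.add haff
    have hWheat : ∀ y : Sp n × ℝ, 0 < y.2 → heatOp W y = heatOp f y - (B + ε) := by
      intro y hy
      rw [hW, heatOp_add hf haff hy, heatOp_const_mul _ (SmoothPos.snd.sub (SmoothPos.const _)) hy]
      have : heatOp (fun y : Sp n × ℝ => y.2 - t₁) y = 1 := by
        have := heatOp_add (SmoothPos.snd (n := n)) (SmoothPos.const (-t₁)) hy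
        simpa [heatOp_snd, heatOp_const, ← sub_eq_add_neg] using this
      rw [this]; ring
    obtain ⟨y, hyK, hymax⟩ := hKc.exists_isMaxOn ⟨z, hz, hz₁, hz₀⟩
      (hWs.continuousOn.mono hKpos)
    have hWy : W y ≤ M := by
      have hle : W y ≤ f y := by
        have : 0 ≤ (B + ε) * (y.2 - t₁) :=
          mul_nonneg (by positivity) (sub_nonneg.2 hyK.2.1)
        simp only [hW]; linarith
      rcases eq_or_lt_of_le hyK.2.1 with hyt | hyt
      · refine hle.trans ?_
        have := hbot y.1 hyK.1
        rwa [hyt] at this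
      rcases eq_or_lt_of_le (show dist y.1 x₀ ≤ r from hyK.1) with hyx | hyx
      · exact hle.trans (hlat y hyx hyK.2.1 hyK.2.2)
      exfalso
      have hypos := hKpos y hyK
      have htime : 0 ≤ dirDeriv (tdir n) W y := by
        have hseg : segment ℝ y (y.1, t₁) ⊆ K := by
          refine ((convex_closedBall x₀ r).prod (convex_Icc t₁ t₀)).segment_subset hyK ?_
          exact ⟨hyK.1, le_rfl, hyK.2.1.trans hyK.2.2⟩
        have h1 := hymax.localize.hasFDerivWithinAt_nonpos
          (hWs.differentiableAt hypos).hasFDerivAt.hasFDerivWithinAt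
          (sub_mem_posTangentConeAt_of_segment_subset hseg)
        have h2 : ((y.1, t₁) : Sp n × ℝ) - y = (t₁ - y.2) • tdir n := by
          ext <;> simp [tdir]
        rw [h2, map_smul, smul_eq_mul] at h1
        exact nonneg_of_mul_nonpos_right h1 (by linarith)
      have hspace : ∀ α, dirDeriv (sdir n α) (dirDeriv (sdir n α) W) y ≤ 0 := by
        intro α
        refine dirDeriv_dirDeriv_nonpos_of_isLocalMax hWs hypos ?_
        have hc : Continuous (fun τ : ℝ => dist (y + τ • sdir n α).1 x₀) := by fun_prop
        have : ∀ᶠ τ : ℝ in nhds 0, dist (y + τ • sdir n α).1 x₀ < r :=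
          hc.continuousAt.eventually (gt_mem_nhds (by simpa using hyx))
        filter_upwards [this] with τ hτ
        have hmem : y + τ • sdir n α ∈ K := ⟨hτ.le, by simpa [sdir] using hyK.2⟩
        simpa using hymax hmem
      have h1 := hWheat y hypos
      have h2 := hint y hyx hyt hyK.2.2
      have h3 : 0 ≤ heatOp W y := sub_nonneg.2 ((Finset.sum_nonpos fun α _ => hspace α).trans htime)
      linarith
    have hzy : W z ≤ W y := hymax (show z ∈ K from ⟨hz, hz₁, hz₀⟩)
    simp only [hW] at hzy hWy
    linarith
  refine le_of_forall_pos_le_add fun ε hε => ?_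
  have h0 : 0 ≤ z.2 - t₁ := sub_nonneg.2 hz₁
  refine (main (ε / (z.2 - t₁ + 1)) (by positivity)).trans ?_
  have : ε / (z.2 - t₁ + 1) * (z.2 - t₁) ≤ ε := by
    rw [div_mul_eq_mul_div, div_le_iff₀ (by positivity)]
    nlinarith
  linarith

/-- Parabolic cut-off of the backward cylinder of radius `c⁻¹ᐟ²` with vertex `z₀`. -/
def cutoff {n : ℕ} (z₀ : Sp n × ℝ) (c : ℝ) (z : Sp n × ℝ) : ℝ :=
  (1 + c * (z.2 - z₀.2)) *
    ((1 - c * ∑ α : Fin n, (z.1 α - z₀.1 α) ^ 2) * (1 - c * ∑ α : Fin n, (z.1 α - z₀.1 α) ^ 2))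

theorem dist_sq_eq_sum (x y : Sp n) : dist x y ^ 2 = ∑ α : Fin n, (x α - y α) ^ 2 := by
  rw [EuclideanSpace.dist_eq, Real.sq_sqrt (Finset.sum_nonneg fun _ _ => sq_nonneg _)]
  simp [Real.dist_eq, sq_abs]

section SquaredDistance

variable (z₀ : Sp n × ℝ) (c : ℝ)

theorem SmoothPos.of_contDiff (hf : ContDiff ℝ (⊤ : ℕ∞) f) : SmoothPos f := hf.contDiffOn

theorem smoothPos_sqDist : SmoothPos (fun z : Sp n × ℝ => ∑ α : Fin n, (z.1 α - z₀.1 α) ^ 2) :=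
  SmoothPos.of_contDiff (by fun_prop)

theorem dirDeriv_sqDist (v : Sp n × ℝ) (hz : 0 < z.2) :
    dirDeriv v (fun z : Sp n × ℝ => ∑ α : Fin n, (z.1 α - z₀.1 α) ^ 2) z
      = ∑ α : Fin n, 2 * (z.1 α - z₀.1 α) * v.1 α := by
  have h1 : ∀ α : Fin n, SmoothPos (fun z : Sp n × ℝ => z.1 α - z₀.1 α) := fun α =>
    (SmoothPos.coord α).sub (SmoothPos.const _)
  simp only [sq]
  rw [dirDeriv_sum (fun α _ => (h1 α).mul (h1 α)) hz]
  refine Finset.sum_congr rfl fun α _ => ?_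
  rw [dirDeriv_mul (h1 α) (h1 α) hz, dirDeriv_sub (SmoothPos.coord α) (SmoothPos.const _) hz,
    dirDeriv_coord, dirDeriv_const]
  ring

theorem dirDeriv_sdir_sqDist (α : Fin n) (hz : 0 < z.2) :
    dirDeriv (sdir n α) (fun z : Sp n × ℝ => ∑ α : Fin n, (z.1 α - z₀.1 α) ^ 2) z
      = 2 * (z.1 α - z₀.1 α) := by
  rw [dirDeriv_sqDist _ _ hz]
  simp [sdir]

theorem heatOp_sqDist (hz : 0 < z.2) :
    heatOp (fun z : Sp n × ℝ => ∑ α : Fin n, (z.1 α - z₀.1 α) ^ 2) z = -(2 * n) := by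
  have h1 : ∀ α : Fin n, SmoothPos (fun z : Sp n × ℝ => z.1 α - z₀.1 α) := fun α =>
    (SmoothPos.coord α).sub (SmoothPos.const _)
  have h2 : ∀ α : Fin n, dirDeriv (sdir n α) (dirDeriv (sdir n α)
      (fun z : Sp n × ℝ => ∑ α : Fin n, (z.1 α - z₀.1 α) ^ 2)) z = 2 := fun α => by
    rw [dirDeriv_congr (fun y hy => dirDeriv_sdir_sqDist z₀ α hy) hz,
      dirDeriv_const_mul _ (h1 α) hz, dirDeriv_sub (SmoothPos.coord α) (SmoothPos.const _) hz,
      dirDeriv_coord, dirDeriv_const]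
    simp [sdir]
  simp only [heatOp, h2, dirDeriv_sqDist _ _ hz]
  simp [tdir, mul_comm]

theorem smoothPos_cutoff : SmoothPos (cutoff z₀ c) :=
  SmoothPos.of_contDiff (by unfold cutoff; fun_prop)

theorem smoothPos_bump :
    SmoothPos (fun z : Sp n × ℝ => 1 - c * ∑ α : Fin n, (z.1 α - z₀.1 α) ^ 2) :=
  SmoothPos.of_contDiff (by fun_prop)

theorem dirDeriv_bump (α : Fin n) (hz : 0 < z.2) :
    dirDeriv (sdir n α) (fun z : Sp n × ℝ => 1 - c * ∑ α : Fin n, (z.1 α - z₀.1 α) ^ 2) z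
      = -(2 * c * (z.1 α - z₀.1 α)) := by
  rw [dirDeriv_sub (SmoothPos.const _) ((SmoothPos.const _).mul (smoothPos_sqDist _)) hz,
    dirDeriv_const, dirDeriv_const_mul _ (smoothPos_sqDist _) hz, dirDeriv_sdir_sqDist _ _ hz]
  ring

theorem heatOp_bump (hz : 0 < z.2) :
    heatOp (fun z : Sp n × ℝ => 1 - c * ∑ α : Fin n, (z.1 α - z₀.1 α) ^ 2) z = 2 * n * c := by
  simp only [sub_eq_add_neg, ← neg_mul]
  have := heatOp_add (SmoothPos.const 1) ((SmoothPos.const (-c)).mul (smoothPos_sqDist z₀)) hz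
  simp only [sub_eq_add_neg] at this
  rw [this, heatOp_const]
  have := heatOp_const_mul (-c) (smoothPos_sqDist z₀) hz
  rw [heatOp_sqDist _ hz] at this
  simp only [sub_eq_add_neg] at this
  rw [this]; ring

theorem heatOp_time_affine (hz : 0 < z.2) :
    heatOp (fun z : Sp n × ℝ => 1 + c * (z.2 - z₀.2)) z = c := by
  have h1 : SmoothPos (fun z : Sp n × ℝ => z.2 + -z₀.2) := SmoothPos.snd.add (SmoothPos.const _)
  simp only [sub_eq_add_neg]
  rw [heatOp_add (SmoothPos.const _) ((SmoothPos.const _).mul h1) hz,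
    heatOp_const_mul _ h1 hz, heatOp_add SmoothPos.snd (SmoothPos.const _) hz, heatOp_const,
    heatOp_const, heatOp_snd]
  ring

theorem smoothPos_time_affine : SmoothPos (fun z : Sp n × ℝ => 1 + c * (z.2 - z₀.2)) :=
  SmoothPos.of_contDiff (by fun_prop)

theorem dirDeriv_time_affine (α : Fin n) (hz : 0 < z.2) :
    dirDeriv (sdir n α) (fun z : Sp n × ℝ => 1 + c * (z.2 - z₀.2)) z = 0 := by
  have h1 : SmoothPos (fun z : Sp n × ℝ => z.2 - z₀.2) := SmoothPos.snd.sub (SmoothPos.const _)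
  rw [dirDeriv_add (SmoothPos.const _) ((SmoothPos.const _).mul h1) hz,
    dirDeriv_const_mul _ h1 hz, dirDeriv_sub SmoothPos.snd (SmoothPos.const _) hz, dirDeriv_const,
    dirDeriv_const, dirDeriv_snd]
  simp [sdir]

theorem dirDeriv_cutoff (α : Fin n) (hz : 0 < z.2) :
    dirDeriv (sdir n α) (cutoff z₀ c) z = -4 * c * (1 + c * (z.2 - z₀.2)) *
      (1 - c * ∑ α : Fin n, (z.1 α - z₀.1 α) ^ 2) * (z.1 α - z₀.1 α) := by
  have hb := smoothPos_bump z₀ c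
  unfold cutoff
  rw [dirDeriv_mul (smoothPos_time_affine z₀ c) (hb.mul hb) hz, dirDeriv_time_affine _ _ _ hz,
    dirDeriv_mul hb hb hz, dirDeriv_bump _ _ _ hz]
  ring

theorem heatOp_cutoff (hz : 0 < z.2) :
    heatOp (cutoff z₀ c) z = c * (1 - c * ∑ α : Fin n, (z.1 α - z₀.1 α) ^ 2) ^ 2
      + (1 + c * (z.2 - z₀.2)) * (4 * n * c * (1 - c * ∑ α : Fin n, (z.1 α - z₀.1 α) ^ 2)
        - 8 * c ^ 2 * ∑ α : Fin n, (z.1 α - z₀.1 α) ^ 2) := by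
  have hb := smoothPos_bump z₀ c
  have hsum : ∑ α : Fin n, -(2 * c * (z.1 α - z₀.1 α)) * -(2 * c * (z.1 α - z₀.1 α))
      = 4 * c ^ 2 * ∑ α : Fin n, (z.1 α - z₀.1 α) ^ 2 := by
    rw [Finset.mul_sum]; exact Finset.sum_congr rfl fun α _ => by ring
  unfold cutoff
  rw [heatOp_mul (smoothPos_time_affine z₀ c) (hb.mul hb) hz, heatOp_time_affine _ _ hz,
    heatOp_mul hb hb hz, heatOp_bump _ _ hz]
  simp only [dirDeriv_bump _ _ _ hz, dirDeriv_time_affine _ _ _ hz, hsum, zero_mul,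
    Finset.sum_const_zero]
  ring

end SquaredDistance

set_option maxHeartbeats 1000000 in
/-- Interior derivative estimate of Bernstein type on the backward cylinder of radius `r`. -/
theorem bernstein_estimate (hf : SmoothPos f) (hg : SmoothPos g) {z₀ : Sp n × ℝ}
    {r K S B₀ B₁ : ℝ} (hr : 0 < r) (hz₀ : r ^ 2 < z₀.2) (hK : 0 ≤ K) (hB₀ : 0 ≤ B₀) (hB₁ : 0 ≤ B₁)
    (hf0 : ∀ z, 0 ≤ f z) (hg0 : ∀ z, 0 ≤ g z) (hh0 : ∀ z, 0 ≤ h z)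
    (hfS : ∀ z : Sp n × ℝ, dist z.1 z₀.1 ≤ r → z₀.2 - r ^ 2 ≤ z.2 → z.2 ≤ z₀.2 → f z ≤ S)
    (hgrad : ∀ z : Sp n × ℝ, 0 < z.2 →
      ∑ α : Fin n, dirDeriv (sdir n α) g z ^ 2 ≤ 4 * g z * h z)
    (hfheat : ∀ z : Sp n × ℝ, dist z.1 z₀.1 < r → z₀.2 - r ^ 2 < z.2 → z.2 ≤ z₀.2 →
      heatOp f z ≤ -g z + B₀)
    (hgheat : ∀ z : Sp n × ℝ, dist z.1 z₀.1 < r → z₀.2 - r ^ 2 < z.2 → z.2 ≤ z₀.2 →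
      heatOp g z ≤ -h z + K / r ^ 2 * g z + B₁) :
    g z₀ ≤ (K + 65 + 4 * n) * (S / r ^ 2 + B₀) + r ^ 2 * B₁ := by
  set c : ℝ := (r ^ 2)⁻¹ with hc
  have hcpos : 0 < c := by positivity
  have hcr : c * r ^ 2 = 1 := inv_mul_cancel₀ (by positivity)
  set A : ℝ := (K + 65 + 4 * n) * c with hA
  have hApos : 0 ≤ A := by positivity
  have hη := smoothPos_cutoff z₀ c
  have hQ : SmoothPos (fun z => cutoff z₀ c z * g z + A * f z) :=
    (hη.mul hg).add ((SmoothPos.const A).mul hf)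
  have hfS0 : f z₀ ≤ S := hfS z₀ (by simpa using hr.le) (by nlinarith) le_rfl
  have main := le_of_heatOp_le (z := z₀) hQ (x₀ := z₀.1) (r := r) (t₁ := z₀.2 - r ^ 2) (t₀ := z₀.2)
    (B := B₁ + A * B₀) (M := A * S) (by linarith) (by positivity) ?_ ?_ ?_
    (by simpa using hr.le) (by nlinarith) le_rfl
  · have h1 : cutoff z₀ c z₀ = 1 := by simp [cutoff]
    have h2 : 0 ≤ A * f z₀ := mul_nonneg hApos (hf0 _)
    rw [h1] at main
    have h3 : (K + 65 + 4 * n) * (S / r ^ 2 + B₀) + r ^ 2 * B₁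
        = A * S + (B₁ + A * B₀) * (z₀.2 - (z₀.2 - r ^ 2)) := by
      rw [hA, div_eq_mul_inv, ← hc]
      linear_combination (-(K + 65 + 4 * n) * B₀) * hcr
    rw [h3]; linarith
  · intro z hzx hzt hzt0
    have hz : 0 < z.2 := by linarith
    rw [heatOp_add (hη.mul hg) ((SmoothPos.const A).mul hf) hz, heatOp_mul hη hg hz,
      heatOp_const_mul A hf hz, heatOp_cutoff _ _ hz]
    simp only [dirDeriv_cutoff _ _ _ hz]
    have hNr : ∑ α : Fin n, (z.1 α - z₀.1 α) ^ 2 ≤ r ^ 2 := by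
      rw [← dist_sq_eq_sum]; exact pow_le_pow_left₀ dist_nonneg hzx.le 2
    set N : ℝ := ∑ α : Fin n, (z.1 α - z₀.1 α) ^ 2 with hN
    have hN0 : 0 ≤ N := Finset.sum_nonneg fun _ _ => sq_nonneg _
    have hcut : cutoff z₀ c z = (1 + c * (z.2 - z₀.2)) * ((1 - c * N) * (1 - c * N)) := rfl
    set τ : ℝ := 1 + c * (z.2 - z₀.2) with hτ
    set b : ℝ := 1 - c * N with hb
    have hτ0 : 0 ≤ τ := by rw [hτ, ← hcr]; nlinarith
    have hτ1 : τ ≤ 1 := by rw [hτ]; nlinarith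
    have hb0 : 0 ≤ b := by rw [hb, ← hcr]; nlinarith
    have hb1 : b ≤ 1 := by rw [hb]; nlinarith
    set P : ℝ := ∑ α : Fin n, (z.1 α - z₀.1 α) * dirDeriv (sdir n α) g z with hP
    have hsum : ∑ α : Fin n, -4 * c * τ * b * (z.1 α - z₀.1 α) * dirDeriv (sdir n α) g z
        = -4 * c * τ * b * P := by
      rw [hP, Finset.mul_sum]; exact Finset.sum_congr rfl fun α _ => by ring
    rw [hsum, hcut]
    have hg0z := hg0 z
    have hh0z := hh0 z
    have hPsq : P ^ 2 ≤ r ^ 2 * (4 * g z * h z) := by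
      refine (Finset.sum_mul_sq_le_sq_mul_sq _ _ _).trans ?_
      exact mul_le_mul hNr (hgrad z hz) (Finset.sum_nonneg fun _ _ => sq_nonneg _) (by positivity)
    have hcross : 8 * c * τ * b * P ≤ τ * b ^ 2 * h z + 64 * c * g z := by
      refine le_of_abs_le (abs_le_of_sq_le_sq ?_ (by positivity))
      calc (8 * c * τ * b * P) ^ 2 = (8 * c * τ * b) ^ 2 * P ^ 2 := by ring
        _ ≤ (8 * c * τ * b) ^ 2 * (r ^ 2 * (4 * g z * h z)) := by gcongr
        _ = τ * (256 * c * τ * b ^ 2 * g z * h z * (c * r ^ 2)) := by ring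
        _ ≤ 1 * (256 * c * τ * b ^ 2 * g z * h z * (c * r ^ 2)) := by
            gcongr
        _ = 4 * (τ * b ^ 2 * h z) * (64 * c * g z) := by rw [hcr]; ring
        _ ≤ _ := by nlinarith [sq_nonneg (τ * b ^ 2 * h z - 64 * c * g z)]
    have hη0 : 0 ≤ τ * (b * b) := by positivity
    have hη1 : τ * (b * b) ≤ 1 := mul_le_one₀ hτ1 (by positivity) (mul_le_one₀ hb1 hb0 hb1)
    have hg1 : τ * (b * b) * heatOp g z ≤ τ * (b * b) * (-h z) + (K * c * g z + B₁) := by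
      refine (mul_le_mul_of_nonneg_left (hgheat z hzx hzt hzt0) hη0).trans ?_
      rw [div_eq_mul_inv, ← hc]
      have : τ * (b * b) * (K * c * g z + B₁) ≤ 1 * (K * c * g z + B₁) := by gcongr
      linarith
    have hη2 : c * b ^ 2 + τ * (4 * n * c * b - 8 * c ^ 2 * N) ≤ c * (1 + 4 * n) := by
      have e1 : c * b ^ 2 ≤ c * 1 := by gcongr; exact pow_le_one₀ hb0 hb1
      have e2 : τ * (4 * n * c * b) ≤ 1 * (4 * n * c * 1) := by gcongr
      have e3 : 0 ≤ τ * (8 * c ^ 2 * N) := by positivity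
      linarith
    have hη3 := mul_le_mul_of_nonneg_right hη2 hg0z
    have hf1 := mul_le_mul_of_nonneg_left (hfheat z hzx hzt hzt0) hApos
    have hAg : A * g z = K * c * g z + 65 * c * g z + 4 * n * c * g z := by rw [hA]; ring
    linarith
  · intro z hzx hzt hzt0
    have hN : ∑ α : Fin n, (z.1 α - z₀.1 α) ^ 2 = r ^ 2 := by rw [← dist_sq_eq_sum, hzx]
    have : cutoff z₀ c z = 0 := by simp [cutoff, hN, hcr]
    simp only [this, zero_mul, zero_add]
    exact mul_le_mul_of_nonneg_left (hfS z hzx.le hzt hzt0) hApos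
  · intro x hx
    have : cutoff z₀ c (x, z₀.2 - r ^ 2) = 0 := by simp [cutoff, hcr]
    simp only [this, zero_mul, zero_add]
    exact mul_le_mul_of_nonneg_left
      (hfS (x, z₀.2 - r ^ 2) hx le_rfl (by simp only []; nlinarith)) hApos

end MaximumPrinciple

/-- A harmonic map heat flow into the sphere, smooth for positive times. -/
structure SphereFlow {n k : ℕ} (u : Sp n × ℝ → Fin k → ℝ) : Prop where
  smooth : ∀ i, SmoothPos (fun z => u z i)
  sphere : ∀ z : Sp n × ℝ, 0 < z.2 → ∑ i, u z i ^ 2 = 1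
  flow : ∀ z : Sp n × ℝ, 0 < z.2 → ∀ i, heatOp (fun w => u w i) z = gradSq u z * u z i

/-- Squared length of the `m`-th spatial derivatives of a vector-valued map. -/
def jetEnergy {n k : ℕ} (m : ℕ) (u : Sp n × ℝ → Fin k → ℝ) (z : Sp n × ℝ) : ℝ :=
  ∑ i, jetInner m (fun w => u w i) (fun w => u w i) z

/-- Sum of the absolute values of all `m`-th spatial derivatives of a vector-valued map. -/
def jetSize {n k : ℕ} (m : ℕ) (u : Sp n × ℝ → Fin k → ℝ) (z : Sp n × ℝ) : ℝ :=
  ∑ i, jetNorm m (fun w => u w i) z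

section Flow

variable {n k : ℕ} {u : Sp n × ℝ → Fin k → ℝ} {z : Sp n × ℝ}

theorem jetEnergy_nonneg (m : ℕ) (u : Sp n × ℝ → Fin k → ℝ) (z : Sp n × ℝ) :
    0 ≤ jetEnergy m u z :=
  Finset.sum_nonneg fun _ _ => jetInner_self_nonneg m _

theorem jetSize_nonneg (m : ℕ) (u : Sp n × ℝ → Fin k → ℝ) (z : Sp n × ℝ) :
    0 ≤ jetSize m u z :=
  Finset.sum_nonneg fun _ _ => jetNorm_nonneg m _

theorem jetNorm_le_jetSize (m : ℕ) (i : Fin k) :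
    jetNorm m (fun w => u w i) z ≤ jetSize m u z :=
  Finset.single_le_sum (f := fun i => jetNorm m (fun w => u w i) z)
    (fun _ _ => jetNorm_nonneg m _) (Finset.mem_univ i)

theorem jetNorm_dirDeriv_le_jetSize (m : ℕ) (α : Fin n) (i : Fin k) :
    jetNorm m (dirDeriv (sdir n α) fun w => u w i) z ≤ jetSize (m + 1) u z :=
  (Finset.single_le_sum (f := fun α => jetNorm m (dirDeriv (sdir n α) fun w => u w i) z)
    (fun _ _ => jetNorm_nonneg m _) (Finset.mem_univ α)).trans (jetNorm_le_jetSize (m + 1) i)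

theorem jetSize_sq_le (m : ℕ) : jetSize m u z ^ 2 ≤ k * n ^ m * jetEnergy m u z := by
  calc jetSize m u z ^ 2 ≤ k * ∑ i, jetNorm m (fun w => u w i) z ^ 2 := by
        simpa [jetSize] using sq_sum_le_card_mul_sum_sq (s := Finset.univ)
          (f := fun i : Fin k => jetNorm m (fun w => u w i) z)
    _ ≤ k * ∑ i, (n : ℝ) ^ m * jetInner m (fun w => u w i) (fun w => u w i) z := by
        gcongr with i; exact jetNorm_sq_le m _
    _ = _ := by rw [← Finset.mul_sum, jetEnergy]; ring

theorem jetEnergy_le_sq (m : ℕ) : jetEnergy m u z ≤ jetSize m u z ^ 2 := by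
  calc jetEnergy m u z ≤ ∑ i, jetNorm m (fun w => u w i) z * jetSize m u z := by
        refine Finset.sum_le_sum fun i _ => (le_abs_self _).trans ((abs_jetInner_le m _ _).trans ?_)
        exact mul_le_mul_of_nonneg_left (jetNorm_le_jetSize m i) (jetNorm_nonneg m _)
    _ = _ := by rw [← Finset.sum_mul, sq]; rfl

theorem gradSq_eq_jetEnergy (u : Sp n × ℝ → Fin k → ℝ) : gradSq u = jetEnergy 1 u := by
  funext z
  simp only [gradSq, jetEnergy, jetInner, sq]
  rw [Finset.sum_comm]; rfl

theorem smoothPos_jetEnergy (hu : ∀ i, SmoothPos (fun z => u z i)) (m : ℕ) :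
    SmoothPos (jetEnergy m u) :=
  SmoothPos.sum fun i _ => (hu i).jetInner (hu i)

theorem sum_sq_dirDeriv_jetEnergy_le (hu : ∀ i, SmoothPos (fun z => u z i)) (m : ℕ)
    (hz : 0 < z.2) : ∑ α, dirDeriv (sdir n α) (jetEnergy m u) z ^ 2
      ≤ 4 * jetEnergy m u z * jetEnergy (m + 1) u z := by
  have h1 : ∀ α, dirDeriv (sdir n α) (jetEnergy m u) z ^ 2 ≤ 4 * (jetEnergy m u z *
      ∑ i, jetInner m (dirDeriv (sdir n α) fun w => u w i) (dirDeriv (sdir n α) fun w => u w i) z) := by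
    intro α
    have : dirDeriv (sdir n α) (jetEnergy m u) z
        = 2 * ∑ i, jetInner m (fun w => u w i) (dirDeriv (sdir n α) fun w => u w i) z := by
      change dirDeriv _ (fun y => ∑ i, jetInner m (fun w => u w i) (fun w => u w i) y) z = _
      rw [dirDeriv_sum (fun i _ => (hu i).jetInner (hu i)) hz, Finset.mul_sum]
      exact Finset.sum_congr rfl fun i _ => dirDeriv_jetInner_self m (hu i) hz
    rw [this, mul_pow]
    have := Finset.sum_sq_le_sum_mul_sum_of_sq_le_mul Finset.univ
      (r := fun i => jetInner m (fun w => u w i) (dirDeriv (sdir n α) fun w => u w i) z)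
      (fun i _ => jetInner_self_nonneg m (z := z) (fun w => u w i))
      (fun i _ => jetInner_self_nonneg m (z := z) (dirDeriv (sdir n α) fun w => u w i))
      (fun i _ => jetInner_sq_le m _ _)
    rw [jetEnergy]
    linarith
  refine (Finset.sum_le_sum fun α _ => h1 α).trans_eq ?_
  rw [← Finset.mul_sum, ← Finset.mul_sum, Finset.sum_comm]
  simp only [jetEnergy, jetInner]
  ring

/-- Leibniz estimate for the derivatives of the energy density. -/
theorem jetNorm_gradSq_le (hu : ∀ i, SmoothPos (fun z => u z i)) (m : ℕ) (hz : 0 < z.2) :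
    jetNorm m (gradSq u) z ≤ n * k * 2 ^ m *
      ∑ p ∈ Finset.HasAntidiagonal.antidiagonal m, jetSize (p.1 + 1) u z * jetSize (p.2 + 1) u z := by
  have h1 : ∀ α i, SmoothPos (fun z => pd u i (sdir n α) z ^ 2) := fun α i => by
    simp only [sq]; exact ((hu i).dirDeriv _).mul ((hu i).dirDeriv _)
  calc jetNorm m (gradSq u) z
      ≤ ∑ α : Fin n, jetNorm m (fun z => ∑ i : Fin k, pd u i (sdir n α) z ^ 2) z :=
        jetNorm_sum_le _ m (fun α _ => SmoothPos.sum fun i _ => h1 α i) hz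
    _ ≤ ∑ α : Fin n, ∑ i : Fin k, jetNorm m (fun z => pd u i (sdir n α) z ^ 2) z :=
        Finset.sum_le_sum fun α _ => jetNorm_sum_le _ m (fun i _ => h1 α i) hz
    _ ≤ ∑ α : Fin n, ∑ i : Fin k, 2 ^ m * ∑ p ∈ Finset.HasAntidiagonal.antidiagonal m,
          jetSize (p.1 + 1) u z * jetSize (p.2 + 1) u z := by
        refine Finset.sum_le_sum fun α _ => Finset.sum_le_sum fun i _ => ?_
        simp only [sq]
        refine (jetNorm_mul_le m ((hu i).dirDeriv _) ((hu i).dirDeriv _) hz).trans ?_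
        gcongr with p
        · exact jetNorm_nonneg _ _
        · exact jetSize_nonneg _ _ _
        · exact jetNorm_dirDeriv_le_jetSize _ α i
        · exact jetNorm_dirDeriv_le_jetSize _ α i
    _ = _ := by simp; ring

namespace SphereFlow

theorem smoothPos_gradSq (hu : SphereFlow u) : SmoothPos (gradSq u) := by
  rw [gradSq_eq_jetEnergy]; exact smoothPos_jetEnergy hu.smooth 1

theorem sum_mul_dirDeriv (hu : SphereFlow u) (v : Sp n × ℝ) (hz : 0 < z.2) :
    ∑ i, u z i * dirDeriv v (fun w => u w i) z = 0 := by
  have h1 : dirDeriv v (fun w => ∑ i, u w i * u w i) z = 0 := by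
    rw [dirDeriv_congr (g := fun _ => 1) (fun y hy => by simpa [sq] using hu.sphere y hy) hz]
    exact dirDeriv_const _ _
  rw [dirDeriv_sum (fun i _ => (hu.smooth i).mul (hu.smooth i)) hz] at h1
  have h2 : ∀ i, dirDeriv v (fun w => u w i * u w i) z
      = 2 * (u z i * dirDeriv v (fun w => u w i) z) := fun i => by
    rw [dirDeriv_mul (hu.smooth i) (hu.smooth i) hz]; ring
  simp only [h2, ← Finset.mul_sum] at h1
  linarith

theorem sum_mul_dirDeriv_dirDeriv (hu : SphereFlow u) (v w : Sp n × ℝ) (hz : 0 < z.2) :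
    ∑ i, u z i * dirDeriv w (dirDeriv v fun y => u y i) z
      = -∑ i, dirDeriv w (fun y => u y i) z * dirDeriv v (fun y => u y i) z := by
  have h1 : dirDeriv w (fun y => ∑ i, u y i * dirDeriv v (fun x => u x i) y) z = 0 := by
    rw [dirDeriv_congr (g := fun _ => 0) (fun y hy => hu.sum_mul_dirDeriv v hy) hz]
    exact dirDeriv_const _ _
  rw [dirDeriv_sum (fun i _ => (hu.smooth i).mul ((hu.smooth i).dirDeriv v)) hz] at h1
  simp only [fun i => dirDeriv_mul (v := w) (hu.smooth i) ((hu.smooth i).dirDeriv v) hz,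
    Finset.sum_add_distrib] at h1
  linarith

theorem heatOp_jetEnergy (hu : SphereFlow u) (m : ℕ) (hz : 0 < z.2) :
    heatOp (jetEnergy m u) z
      = 2 * ∑ i, jetInner m (fun w => u w i) (fun w => gradSq u w * u w i) z
        - 2 * jetEnergy (m + 1) u z := by
  change heatOp (fun y => ∑ i, jetInner m (fun w => u w i) (fun w => u w i) y) z = _
  rw [heatOp_sum (fun i _ => (hu.smooth i).jetInner (hu.smooth i)) hz, jetEnergy, Finset.mul_sum,
    Finset.mul_sum, ← Finset.sum_sub_distrib]
  refine Finset.sum_congr rfl fun i _ => ?_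
  rw [heatOp_jetInner_self m (hu.smooth i) hz,
    jetInner_congr m (fun _ _ => rfl) (fun y hy => hu.flow y hy i) hz]

/-- Bochner formula for the energy density. -/
theorem heatOp_jetEnergy_one (hu : SphereFlow u) (hz : 0 < z.2) :
    heatOp (jetEnergy 1 u) z = 2 * jetEnergy 1 u z ^ 2 - 2 * jetEnergy 2 u z := by
  rw [hu.heatOp_jetEnergy 1 hz]
  have he := hu.smoothPos_gradSq
  have h1 : ∀ i, jetInner 1 (fun w => u w i) (fun w => gradSq u w * u w i) z
      = ∑ α, (gradSq u z * (dirDeriv (sdir n α) (fun w => u w i) z * dirDeriv (sdir n α) (fun w => u w i) z)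
        + dirDeriv (sdir n α) (gradSq u) z * (u z i * dirDeriv (sdir n α) (fun w => u w i) z)) := by
    intro i
    refine Finset.sum_congr rfl fun α _ => ?_
    simp only [jetInner]
    rw [dirDeriv_mul he (hu.smooth i) hz]
    ring
  have h2 : ∑ i, jetInner 1 (fun w => u w i) (fun w => gradSq u w * u w i) z
      = gradSq u z * jetEnergy 1 u z := by
    simp only [h1, Finset.sum_add_distrib]
    rw [Finset.sum_comm (f := fun i α => dirDeriv (sdir n α) (gradSq u) z
      * (u z i * dirDeriv (sdir n α) (fun w => u w i) z))]
    simp only [← Finset.mul_sum, hu.sum_mul_dirDeriv _ hz, mul_zero, Finset.sum_const_zero,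
      add_zero]
    rfl
  rw [h2, gradSq_eq_jetEnergy]
  ring

theorem sum_jetInner_two_le (hu : SphereFlow u) (hz : 0 < z.2) :
    ∑ i, jetInner 2 (fun w => u w i) (fun w => gradSq u w * u w i) z
      ≤ 5 * jetEnergy 1 u z * jetEnergy 2 u z + jetNorm 2 (gradSq u) z * jetEnergy 1 u z := by
  have he := hu.smoothPos_gradSq
  set e := gradSq u with hedef
  have heE : e = jetEnergy 1 u := gradSq_eq_jetEnergy u
  let D1 : Fin n → Fin k → ℝ := fun α i => dirDeriv (sdir n α) (fun w => u w i) z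
  let D2 : Fin n → Fin n → Fin k → ℝ :=
    fun α β i => dirDeriv (sdir n β) (dirDeriv (sdir n α) fun w => u w i) z
  let e1 : Fin n → ℝ := fun α => dirDeriv (sdir n α) e z
  let e2 : Fin n → Fin n → ℝ := fun α β => dirDeriv (sdir n β) (dirDeriv (sdir n α) e) z
  have hD2comm : ∀ α β i, D2 α β i = D2 β α i := fun α β i => dirDeriv_comm (hu.smooth i) hz
  have hE2 : jetEnergy 2 u z = ∑ i, ∑ α, ∑ β, D2 α β i * D2 α β i := rfl
  have hE1 : jetEnergy 1 u z = ∑ i, ∑ α, D1 α i * D1 α i := rfl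
  have hez : e z = jetEnergy 1 u z := by rw [heE]
  have hexp : ∀ i, jetInner 2 (fun w => u w i) (fun w => e w * u w i) z
      = ∑ α, ∑ β, (e z * (D2 α β i * D2 α β i) + e1 β * (D2 α β i * D1 α i)
          + e1 α * (D2 α β i * D1 β i) + e2 α β * (u z i * D2 α β i)) := by
    intro i
    refine Finset.sum_congr rfl fun α _ => Finset.sum_congr rfl fun β _ => ?_
    simp only [jetInner]
    rw [dirDeriv_congr (fun y hy => dirDeriv_mul he (hu.smooth i) hy) hz,
      dirDeriv_add (he.mul ((hu.smooth i).dirDeriv _)) ((he.dirDeriv _).mul (hu.smooth i)) hz,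
      dirDeriv_mul he ((hu.smooth i).dirDeriv _) hz, dirDeriv_mul (he.dirDeriv _) (hu.smooth i) hz]
    simp only [D1, D2, e1, e2]
    ring
  have hgrad : ∀ β, e1 β = 2 * ∑ i, ∑ α, D2 α β i * D1 α i := by
    intro β
    have : e1 β = dirDeriv (sdir n β)
      (fun y => ∑ i, jetInner 1 (fun w => u w i) (fun w => u w i) y) z := by
      simp only [e1, heE]; rfl
    rw [this, dirDeriv_sum (fun i _ => (hu.smooth i).jetInner (hu.smooth i)) hz, Finset.mul_sum]
    refine Finset.sum_congr rfl fun i _ => ?_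
    rw [dirDeriv_jetInner_self 1 (hu.smooth i) hz]
    congr 1
    refine Finset.sum_congr rfl fun α _ => ?_
    simp only [jetInner, D2, D1]
    rw [dirDeriv_comm (hu.smooth i) hz]; ring
  have horth : ∀ α β, ∑ i, u z i * D2 α β i = -∑ i, D1 β i * D1 α i := fun α β =>
    hu.sum_mul_dirDeriv_dirDeriv _ _ hz
  have hT : ∀ α β, |∑ i, D1 β i * D1 α i| ≤ jetEnergy 1 u z := by
    intro α β
    have h1 : ∀ γ : Fin n, ∑ i, D1 γ i ^ 2 ≤ jetEnergy 1 u z := by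
      intro γ
      rw [hE1, Finset.sum_comm]
      simp only [sq]
      exact Finset.single_le_sum (f := fun γ => ∑ i, D1 γ i * D1 γ i)
        (fun γ _ => Finset.sum_nonneg fun i _ => mul_self_nonneg _) (Finset.mem_univ γ)
    refine abs_le_of_sq_le_sq ?_ (jetEnergy_nonneg 1 u z)
    refine (Finset.sum_mul_sq_le_sq_mul_sq _ _ _).trans ?_
    rw [sq]
    exact mul_le_mul (h1 β) (h1 α) (Finset.sum_nonneg fun _ _ => sq_nonneg _)
      (jetEnergy_nonneg 1 u z)
  have hgradle : ∑ β, e1 β ^ 2 ≤ 4 * jetEnergy 1 u z * jetEnergy 2 u z := by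
    simp only [e1, heE]
    exact sum_sq_dirDeriv_jetEnergy_le hu.smooth 1 hz
  have s1 : ∑ i, ∑ α, ∑ β, e z * (D2 α β i * D2 α β i) = jetEnergy 1 u z * jetEnergy 2 u z := by
    simp only [← Finset.mul_sum, hE2, hez]
  have s2 : ∑ i, ∑ α, ∑ β, e1 β * (D2 α β i * D1 α i) = ∑ β, e1 β ^ 2 / 2 := by
    have : ∀ i, ∑ α, ∑ β, e1 β * (D2 α β i * D1 α i) = ∑ β, ∑ α, e1 β * (D2 α β i * D1 α i) :=
      fun i => Finset.sum_comm
    simp only [this]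
    rw [Finset.sum_comm]
    refine Finset.sum_congr rfl fun β _ => ?_
    simp only [← Finset.mul_sum]
    have := hgrad β
    rw [show ∑ i, ∑ α, D2 α β i * D1 α i = e1 β / 2 by linarith]
    ring
  have s3 : ∑ i, ∑ α, ∑ β, e1 α * (D2 α β i * D1 β i) = ∑ β, e1 β ^ 2 / 2 := by
    rw [← s2]
    refine Finset.sum_congr rfl fun i _ => ?_
    rw [Finset.sum_comm]
    exact Finset.sum_congr rfl fun α _ => Finset.sum_congr rfl fun β _ => by rw [hD2comm]
  have s4 : ∑ i, ∑ α, ∑ β, e2 α β * (u z i * D2 α β i) ≤ jetNorm 2 e z * jetEnergy 1 u z := by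
    rw [Finset.sum_comm]
    have : ∀ α, ∑ i, ∑ β, e2 α β * (u z i * D2 α β i)
        = ∑ β, e2 α β * -∑ i, D1 β i * D1 α i := by
      intro α
      rw [Finset.sum_comm]
      refine Finset.sum_congr rfl fun β _ => ?_
      rw [← Finset.mul_sum, horth]
    simp only [this, jetNorm, Finset.sum_mul]
    refine Finset.sum_le_sum fun α _ => Finset.sum_le_sum fun β _ => ?_
    refine (le_abs_self _).trans ?_
    rw [abs_mul, abs_neg]
    exact mul_le_mul_of_nonneg_left (hT α β) (abs_nonneg _)
  simp only [hexp, Finset.sum_add_distrib]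
  rw [s1, s2, s3, ← Finset.sum_div]
  linarith

end SphereFlow

end Flow

section Inequalities

variable {n k : ℕ} {u : Sp n × ℝ → Fin k → ℝ} {z : Sp n × ℝ}

theorem mul_le_add_of_sq_le {a b D E : ℝ} (hD : 0 ≤ D) (hE : 0 ≤ E) (hb : b ^ 2 ≤ D * E) :
    a * b ≤ E + D * a ^ 2 / 4 := by
  refine le_of_abs_le (abs_le_of_sq_le_sq ?_ (by positivity))
  have h1 : (a * b) ^ 2 ≤ a ^ 2 * (D * E) := by
    rw [mul_pow]; exact mul_le_mul_of_nonneg_left hb (sq_nonneg _)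
  nlinarith [sq_nonneg (E - D * a ^ 2 / 4)]

theorem SphereFlow.heatOp_jetEnergy_two_le (hu : SphereFlow u) (hz : 0 < z.2) :
    heatOp (jetEnergy 2 u) z ≤ -jetEnergy 3 u z + (10 + 8 * k ^ 2 * n ^ 3) *
      (jetEnergy 1 u z * jetEnergy 2 u z) + 64 * k ^ 4 * n ^ 6 * jetEnergy 1 u z ^ 3 := by
  have h1 := hu.sum_jetInner_two_le hz
  have h2 := jetNorm_gradSq_le hu.smooth 2 hz
  rw [hu.heatOp_jetEnergy 2 hz]
  have ha : Finset.HasAntidiagonal.antidiagonal 2 = {(0, 2), (1, 1), ((2 : ℕ), (0 : ℕ))} := by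
    decide
  rw [ha] at h2
  simp only [Finset.mem_insert, Prod.mk.injEq, Finset.mem_singleton, Finset.sum_insert,
    Finset.sum_singleton, OfNat.zero_ne_ofNat, OfNat.one_ne_ofNat, false_and,
    zero_ne_one, OfNat.ofNat_ne_zero, or_self, not_false_eq_true, and_self, one_ne_zero] at h2
  norm_num at h2
  have hE1 := jetEnergy_nonneg 1 u z
  have hE2 := jetEnergy_nonneg 2 u z
  have hE3 := jetEnergy_nonneg 3 u z
  have q1 := jetSize_sq_le (u := u) (z := z) 1
  have q2 := jetSize_sq_le (u := u) (z := z) 2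
  have q3 := jetSize_sq_le (u := u) (z := z) 3
  set E1 := jetEnergy 1 u z
  set E2 := jetEnergy 2 u z
  set E3 := jetEnergy 3 u z
  set U1 := jetSize 1 u z
  set U2 := jetSize 2 u z
  set U3 := jetSize 3 u z
  have h3 := mul_le_add_of_sq_le (a := 16 * n * k * U1 * E1) (by positivity) hE3 q3
  have h4 : (k : ℝ) * n ^ 3 * (16 * n * k * U1 * E1) ^ 2 / 4 ≤ 64 * k ^ 4 * n ^ 6 * E1 ^ 3 := by
    calc (k : ℝ) * n ^ 3 * (16 * n * k * U1 * E1) ^ 2 / 4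
        = 64 * k ^ 3 * n ^ 5 * E1 ^ 2 * U1 ^ 2 := by ring
      _ ≤ 64 * k ^ 3 * n ^ 5 * E1 ^ 2 * (k * n ^ 1 * E1) := by gcongr
      _ = _ := by ring
  have h5 : 8 * n * k * E1 * U2 ^ 2 ≤ 8 * n * k * E1 * (k * n ^ 2 * E2) := by gcongr
  have h6 := mul_le_mul_of_nonneg_right h2 hE1
  nlinarith

theorem SphereFlow.jetSize_zero_le (hu : SphereFlow u) (hz : 0 < z.2) : jetSize 0 u z ≤ k := by
  have h : ∀ i, |u z i| ≤ 1 := fun i => by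
    rw [← sq_le_one_iff_abs_le_one, ← hu.sphere z hz]
    exact Finset.single_le_sum (f := fun i => u z i ^ 2) (fun _ _ => sq_nonneg _)
      (Finset.mem_univ i)
  calc jetSize 0 u z ≤ ∑ _i : Fin k, (1 : ℝ) := Finset.sum_le_sum fun i _ => h i
    _ = k := by simp

theorem two_mul_sub_le_of_sq_le {G δ D D' V W E E' : ℝ} (hG : 0 ≤ G) (hδ0 : 0 ≤ δ) (hδ1 : δ ≤ 1)
    (hD : 0 ≤ D) (hD' : 0 ≤ D') (hE : 0 ≤ E) (hE' : 0 ≤ E') (hVE : V ^ 2 ≤ D * E)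
    (hWE : W ^ 2 ≤ D' * E') :
    G * δ * V * W + G * δ * V ^ 2 + G * δ * V
      ≤ E' + (D' * G ^ 2 * D + 2 * G * D + G) * E + (D' * G ^ 2 * D + 2 * G * D + G) * δ := by
  have h3 := mul_le_add_of_sq_le (a := G * δ * V) hD' hE' hWE
  have hδ2 : δ ^ 2 ≤ 1 := pow_le_one₀ hδ0 hδ1
  have h4 : D' * (G * δ * V) ^ 2 / 4 ≤ D' * G ^ 2 * D * E := by
    calc D' * (G * δ * V) ^ 2 / 4
        = (D' * G ^ 2 / 4) * (δ ^ 2 * V ^ 2) := by ring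
      _ ≤ (D' * G ^ 2) * (1 * (D * E)) := by
          have : 0 ≤ D' * G ^ 2 := by positivity
          gcongr
          linarith
      _ = _ := by ring
  have h6 : G * δ * V ^ 2 ≤ G * D * E := by
    calc G * δ * V ^ 2 ≤ G * 1 * (D * E) := by gcongr
      _ = _ := by ring
  have hGδ := mul_nonneg hG hδ0
  have h7 : G * δ * V ≤ G * δ + G * δ * V ^ 2 := by
    have : V ≤ 1 + V ^ 2 := by nlinarith [sq_nonneg (V - 1)]
    calc G * δ * V ≤ G * δ * (1 + V ^ 2) := by gcongr
      _ = _ := by ring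
  have h8 : 0 ≤ (D' * G ^ 2 * D + 2 * G * D) * δ := by positivity
  have h9 : 0 ≤ G * E := by positivity
  linarith

/-- The differential inequality for higher derivatives when the lower ones are small. -/
theorem exists_heatOp_jetEnergy_le (n k : ℕ) {m : ℕ} (hm : 1 ≤ m) :
    ∃ C : ℝ, 0 ≤ C ∧ ∀ (u : Sp n × ℝ → Fin k → ℝ), SphereFlow u → ∀ z : Sp n × ℝ, 0 < z.2 →
      ∀ δ : ℝ, 0 ≤ δ → δ ≤ 1 → (∀ j, 1 ≤ j → j ≤ max (m - 1) 1 → jetSize j u z ≤ δ) →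
        heatOp (jetEnergy m u) z ≤ -jetEnergy (m + 1) u z + C * jetEnergy m u z + C * δ := by
  have hE1 : ∀ (u : Sp n × ℝ → Fin k → ℝ) z δ, 0 ≤ δ → δ ≤ 1 → jetSize 1 u z ≤ δ →
      jetEnergy 1 u z ≤ δ := fun u z δ hδ0 hδ1 h => by
    have := jetSize_nonneg 1 u z
    exact jetEnergy_le_sq 1 |>.trans (by nlinarith)
  rcases (by lia : m = 1 ∨ m = 2 ∨ 3 ≤ m) with rfl | rfl | hm3
  · refine ⟨2, by norm_num, fun u hu z hz δ hδ0 hδ1 h => ?_⟩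
    have h1 := hE1 u z δ hδ0 hδ1 (h 1 le_rfl (by simp))
    have h2 := jetEnergy_nonneg 1 u z
    have h3 := jetEnergy_nonneg 2 u z
    rw [hu.heatOp_jetEnergy_one hz]
    norm_num
    nlinarith
  · set C : ℝ := 10 + 8 * k ^ 2 * n ^ 3
    set C' : ℝ := 64 * k ^ 4 * n ^ 6
    have hC : 0 ≤ C := by positivity
    have hC' : 0 ≤ C' := by positivity
    refine ⟨C + C', by positivity, fun u hu z hz δ hδ0 hδ1 h => ?_⟩
    have h1 := hE1 u z δ hδ0 hδ1 (h 1 le_rfl (by simp))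
    have h2 := jetEnergy_nonneg 1 u z
    have h3 := jetEnergy_nonneg 2 u z
    have h4 := hu.heatOp_jetEnergy_two_le hz
    have h5 : C * (jetEnergy 1 u z * jetEnergy 2 u z) ≤ C * jetEnergy 2 u z :=
      mul_le_mul_of_nonneg_left (mul_le_of_le_one_left h3 (h1.trans hδ1)) hC
    have h6 : C' * jetEnergy 1 u z ^ 3 ≤ C' * δ := by
      gcongr
      exact (pow_le_of_le_one h2 (h1.trans hδ1) (by norm_num)).trans h1
    norm_num at h4 ⊢
    nlinarith [mul_nonneg hC' h3, mul_nonneg hC hδ0]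
  · set A : ℝ := ∑ p ∈ Finset.HasAntidiagonal.antidiagonal m, n * k * 2 ^ p.1 *
      ∑ _q ∈ Finset.HasAntidiagonal.antidiagonal p.1, (k + 1 : ℝ)
    have hA : 0 ≤ A := by positivity
    set G : ℝ := 2 * 2 ^ m * A
    have hG : 0 ≤ G := by positivity
    refine ⟨k * n ^ (m + 1) * G ^ 2 * (k * n ^ m) + 2 * G * (k * n ^ m) + G, by positivity,
      fun u hu z hz δ hδ0 hδ1 h => ?_⟩
    have hU : ∀ j, 1 ≤ j → j ≤ m - 1 → jetSize j u z ≤ δ := fun j h1 h2 => h j h1 (by lia)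
    have hU0 := hu.jetSize_zero_le hz
    have hpos := fun j => jetSize_nonneg j u z
    set X : ℝ := jetSize (m + 1) u z + jetSize m u z + 1 with hX
    have hX1 : 1 ≤ X := by linarith [hpos (m + 1), hpos m]
    have hUm : jetSize m u z ≤ X := by linarith [hpos (m + 1)]
    have hUm1 : jetSize (m + 1) u z ≤ X := by linarith [hpos m]
    have hk0 : (0 : ℝ) ≤ k := by positivity
    have hle : ∀ a b c : ℕ, a + b + c = m → b ≤ a →
        jetSize (a + 1) u z * jetSize (b + 1) u z * jetSize c u z ≤ (k + 1) * δ * X := by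
      intro a b c habc hba
      have hUa : jetSize (a + 1) u z ≤ X := by
        rcases (by lia : a = m ∨ a + 1 = m ∨ a + 1 ≤ m - 1) with rfl | h1 | h1
        · exact hUm1
        · rw [h1]; exact hUm
        · exact (hU _ (by lia) h1).trans (by linarith)
      have hUb : jetSize (b + 1) u z ≤ δ := hU _ (by lia) (by lia)
      by_cases hcm : c = m
      · obtain ⟨rfl, rfl⟩ : a = 0 ∧ b = 0 := by lia
        have h1 : jetSize (0 + 1) u z * jetSize (0 + 1) u z ≤ (k + 1) * δ := by
          nlinarith [hpos (0 + 1), mul_nonneg hk0 hδ0]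
        rw [hcm]
        exact mul_le_mul h1 hUm (hpos _) (by positivity)
      · have hUc : jetSize c u z ≤ k + 1 := by
          rcases Nat.eq_zero_or_pos c with rfl | hc
          · linarith
          · linarith [hU c hc (by lia)]
        calc jetSize (a + 1) u z * jetSize (b + 1) u z * jetSize c u z ≤ X * δ * (k + 1) :=
            mul_le_mul (mul_le_mul hUa hUb (hpos _) (by linarith)) hUc (hpos _) (by positivity)
          _ = _ := by ring
    have hle' : ∀ a b c : ℕ, a + b + c = m →
        jetSize (a + 1) u z * jetSize (b + 1) u z * jetSize c u z ≤ (k + 1) * δ * X := by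
      intro a b c habc
      rcases le_total b a with h1 | h1
      · exact hle a b c habc h1
      · rw [mul_comm (jetSize (a + 1) u z)]; exact hle b a c (by lia) h1
    have hprod : ∀ i, jetNorm m (fun w => gradSq u w * u w i) z ≤ 2 ^ m * (A * (δ * X)) := by
      intro i
      refine (jetNorm_mul_le m hu.smoothPos_gradSq (hu.smooth i) hz).trans ?_
      gcongr
      rw [Finset.sum_mul]
      refine Finset.sum_le_sum fun p hp => ?_
      rw [Finset.HasAntidiagonal.mem_antidiagonal] at hp
      calc jetNorm p.1 (gradSq u) z * jetNorm p.2 (fun w => u w i) z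
          ≤ (n * k * 2 ^ p.1 * ∑ q ∈ Finset.HasAntidiagonal.antidiagonal p.1,
            jetSize (q.1 + 1) u z * jetSize (q.2 + 1) u z) * jetSize p.2 u z :=
            mul_le_mul (jetNorm_gradSq_le hu.smooth p.1 hz) (jetNorm_le_jetSize _ i)
              (jetNorm_nonneg _ _) (mul_nonneg (by positivity)
                (Finset.sum_nonneg fun q _ => mul_nonneg (hpos _) (hpos _)))
        _ = n * k * 2 ^ p.1 * ∑ q ∈ Finset.HasAntidiagonal.antidiagonal p.1,
            jetSize (q.1 + 1) u z * jetSize (q.2 + 1) u z * jetSize p.2 u z := by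
            rw [← Finset.sum_mul]; ring
        _ ≤ n * k * 2 ^ p.1 * ∑ _q ∈ Finset.HasAntidiagonal.antidiagonal p.1,
            (k + 1) * δ * X := by
            refine mul_le_mul_of_nonneg_left (Finset.sum_le_sum fun q hq => ?_) (by positivity)
            rw [Finset.HasAntidiagonal.mem_antidiagonal] at hq
            exact hle' q.1 q.2 p.2 (by lia)
        _ = _ := by simp only [Finset.sum_const, nsmul_eq_mul]; ring
    have hsum : ∑ i, jetInner m (fun w => u w i) (fun w => gradSq u w * u w i) z
        ≤ jetSize m u z * (2 ^ m * (A * (δ * X))) := by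
      rw [jetSize, Finset.sum_mul]
      refine Finset.sum_le_sum fun i _ => ?_
      refine (le_abs_self _).trans ((abs_jetInner_le m _ _).trans ?_)
      exact mul_le_mul_of_nonneg_left (hprod i) (jetNorm_nonneg _ _)
    have h5 : 2 * ∑ i, jetInner m (fun w => u w i) (fun w => gradSq u w * u w i) z
        ≤ G * δ * jetSize m u z * jetSize (m + 1) u z + G * δ * jetSize m u z ^ 2
          + G * δ * jetSize m u z := by
      have : 2 * (jetSize m u z * (2 ^ m * (A * (δ * X)))) = G * δ * jetSize m u z *
          jetSize (m + 1) u z + G * δ * jetSize m u z ^ 2 + G * δ * jetSize m u z := by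
        simp only [G, hX]; ring
      linarith
    rw [hu.heatOp_jetEnergy m hz]
    have := two_mul_sub_le_of_sq_le hG hδ0 hδ1 (by positivity : (0 : ℝ) ≤ k * n ^ m)
      (by positivity : (0 : ℝ) ≤ k * n ^ (m + 1)) (jetEnergy_nonneg m u z)
      (jetEnergy_nonneg (m + 1) u z) (jetSize_sq_le (u := u) (z := z) m)
      (jetSize_sq_le (u := u) (z := z) (m + 1))
    linarith

end Inequalities

section Slices

variable {n : ℕ} {f : Sp n × ℝ → ℝ}

theorem fderiv_prod_zero_eq_sum (z : Sp n × ℝ) (v : Sp n) :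
    fderiv ℝ f z (v, 0) = ∑ α, v α * dirDeriv (sdir n α) f z := by
  have hv : ((v, 0) : Sp n × ℝ) = ∑ α, v α • sdir n α := by
    have h := (EuclideanSpace.basisFun (Fin n) ℝ).sum_repr v
    simp only [EuclideanSpace.basisFun_repr, EuclideanSpace.basisFun_apply] at h
    refine Prod.ext ?_ ?_
    · rw [Prod.fst_sum]; exact h.symm
    · rw [Prod.snd_sum]; simp [sdir]
  rw [hv, map_sum]
  exact Finset.sum_congr rfl fun α _ => by rw [map_smul]; rfl

theorem SmoothPos.hasFDerivAt_slice (hf : SmoothPos f) {x : Sp n} {s : ℝ} (hs : 0 < s) :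
    HasFDerivAt (fun y => f (y, s)) ((fderiv ℝ f (x, s)).comp (ContinuousLinearMap.inl ℝ (Sp n) ℝ))
      x :=
  HasFDerivAt.comp x (hf.differentiableAt (z := (x, s)) hs).hasFDerivAt (hasFDerivAt_prodMk_left x s)

theorem norm_fderiv_comp_inl_le {z : Sp n × ℝ} {L : ℝ} (hL : 0 ≤ L)
    (h : ∑ α, dirDeriv (sdir n α) f z ^ 2 ≤ L ^ 2) :
    ‖(fderiv ℝ f z).comp (ContinuousLinearMap.inl ℝ (Sp n) ℝ)‖ ≤ L := by
  refine ContinuousLinearMap.opNorm_le_bound _ hL fun v => ?_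
  change ‖fderiv ℝ f z (v, 0)‖ ≤ _
  rw [fderiv_prod_zero_eq_sum, Real.norm_eq_abs]
  refine abs_le_of_sq_le_sq ?_ (by positivity)
  calc _ ≤ (∑ α, v α ^ 2) * ∑ α, dirDeriv (sdir n α) f z ^ 2 :=
        Finset.sum_mul_sq_le_sq_mul_sq _ _ _
    _ ≤ ‖v‖ ^ 2 * L ^ 2 := by
        rw [EuclideanSpace.norm_sq_eq]
        simp only [Real.norm_eq_abs, sq_abs]
        gcongr
    _ = _ := by ring

theorem SmoothPos.abs_sub_le (hf : SmoothPos f) {x₀ x y : Sp n} {r s L : ℝ} (hs : 0 < s)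
    (hL : 0 ≤ L) (h : ∀ x, dist x x₀ ≤ r → ∑ α, _root_.dirDeriv (sdir n α) f (x, s) ^ 2 ≤ L ^ 2)
    (hx : dist x x₀ ≤ r) (hy : dist y x₀ ≤ r) : |f (x, s) - f (y, s)| ≤ L * dist x y := by
  have := (convex_closedBall x₀ r).norm_image_sub_le_of_norm_hasFDerivWithin_le
    (f := fun y => f (y, s)) (C := L)
    (fun x _ => (hf.hasFDerivAt_slice hs).hasFDerivWithinAt)
    (fun x hx => norm_fderiv_comp_inl_le hL (h x hx)) hy hx
  rwa [Real.norm_eq_abs, ← dist_eq_norm] at this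

end Slices

section Cylinders

variable {n : ℕ} {f : Sp n × ℝ → ℝ} {z : Sp n × ℝ} {r r' : ℝ}

theorem measurableSet_pcyl : MeasurableSet (pcyl z r) :=
  measurableSet_closedBall.prod measurableSet_Ioc

theorem ContinuousOn.integrableOn_pcyl (hf : ContinuousOn f {z : Sp n × ℝ | 0 < z.2})
    (h : r ^ 2 < z.2) : IntegrableOn f (pcyl z r) := by
  have hK : IsCompact (closedBall z.1 r ×ˢ Icc (z.2 - r ^ 2) z.2) :=
    (isCompact_closedBall _ _).prod isCompact_Icc
  refine ((hf.mono fun w hw => ?_).integrableOn_compact hK).mono_set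
    (Set.prod_mono le_rfl Ioc_subset_Icc_self)
  have := hw.2.1
  change 0 < w.2
  linarith

/-- Volume of the unit ball. -/
def ballVol (n : ℕ) : ℝ := volume.real (ball (0 : Sp n) 1)

theorem ballVol_pos (n : ℕ) : 0 < ballVol n :=
  ENNReal.toReal_pos (measure_ball_pos _ _ one_pos).ne' measure_ball_lt_top.ne

theorem volume_real_pcyl (hr : 0 ≤ r) : volume.real (pcyl z r) = ballVol n * r ^ (n + 2) := by
  rw [pcyl, Measure.volume_eq_prod, measureReal_prod_prod, Measure.addHaar_real_closedBall _ _ hr,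
    Real.volume_real_Ioc_of_le (by nlinarith), finrank_euclideanSpace_fin, ballVol]
  ring

theorem volume_pcyl_ne_top : volume (pcyl z r) ≠ ⊤ :=
  (((isCompact_closedBall z.1 r).prod (isCompact_Icc (a := z.2 - r ^ 2) (b := z.2))).measure_lt_top.ne
    |> ne_top_of_le_ne_top) (measure_mono (Set.prod_mono le_rfl Ioc_subset_Icc_self))

theorem pcyl_subset_pcyl (hr : 0 ≤ r) (h : r ≤ r') : pcyl z r ⊆ pcyl z r' := by
  refine Set.prod_mono (closedBall_subset_closedBall h) (Ioc_subset_Ioc_left ?_)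
  nlinarith

theorem mul_ballVol_le_setIntegral (hf : SmoothPos f) (hf0 : ∀ z, 0 ≤ f z) {c : ℝ} (hr : 0 ≤ r)
    (h : r ≤ r') (hr' : r' ^ 2 < z.2) (hc : ∀ w ∈ pcyl z r, c ≤ f w) :
    c * (ballVol n * r ^ (n + 2)) ≤ ∫ w in pcyl z r', f w := by
  have hi := hf.continuousOn.integrableOn_pcyl hr'
  rw [← volume_real_pcyl (z := z) hr]
  refine (setIntegral_ge_of_const_le_real measurableSet_pcyl volume_pcyl_ne_top hc
    (hi.mono_set (pcyl_subset_pcyl hr h))).trans ?_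
  exact setIntegral_mono_set hi (ae_of_all _ hf0) (pcyl_subset_pcyl hr h).eventuallyLE

end Cylinders

section Harnack

variable {n k : ℕ}

/-- Second derivative bound on a scale where the energy density is at most the inverse square. -/
theorem exists_jetEnergy_two_le (n k : ℕ) {L : ℝ} (hL : 0 ≤ L) : ∃ C : ℝ, 1 ≤ C ∧
    ∀ u : Sp n × ℝ → Fin k → ℝ, SphereFlow u → ∀ (z : Sp n × ℝ) (r S : ℝ), 0 < r → r ^ 2 < z.2 →
      (∀ w : Sp n × ℝ, dist w.1 z.1 ≤ r → z.2 - r ^ 2 ≤ w.2 → w.2 ≤ z.2 → gradSq u w ≤ S) →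
      r ^ 2 * S ≤ L → jetEnergy 2 u z ≤ C * (S / r ^ 2) := by
  set K₂ : ℝ := 10 + 8 * k ^ 2 * n ^ 3 with hK₂
  set K₃ : ℝ := 64 * k ^ 4 * n ^ 6 with hK₃
  have hK₂0 : 0 ≤ K₂ := by positivity
  have hK₃0 : 0 ≤ K₃ := by positivity
  refine ⟨(K₂ * L + 65 + 4 * n) * (1 + 2 * L) + K₃ * L ^ 2, ?_, fun u hu z r S hr hz hS hrS => ?_⟩
  · have h1 : 0 ≤ K₂ * L + 64 + 4 * n := by positivity
    have h2 : 0 ≤ K₃ * L ^ 2 := by positivity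
    nlinarith
  have hS0 : 0 ≤ S := (jetEnergy_nonneg 1 u z).trans (by
    rw [← gradSq_eq_jetEnergy]; exact hS z (by simp [hr.le]) (by nlinarith) le_rfl)
  have hpos : ∀ w : Sp n × ℝ, z.2 - r ^ 2 < w.2 → 0 < w.2 := fun w hw => by linarith
  rw [gradSq_eq_jetEnergy] at hS
  have hb := bernstein_estimate (smoothPos_jetEnergy hu.smooth 1) (smoothPos_jetEnergy hu.smooth 2)
    (h := jetEnergy 3 u) hr hz (K := K₂ * L) (S := S) (B₀ := 2 * S ^ 2) (B₁ := K₃ * S ^ 3)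
    (by positivity) (by positivity) (by positivity) (jetEnergy_nonneg 1 u) (jetEnergy_nonneg 2 u)
    (jetEnergy_nonneg 3 u) hS (fun w hw => sum_sq_dirDeriv_jetEnergy_le hu.smooth 2 hw)
    (fun w h1 h2 h3 => by
      rw [hu.heatOp_jetEnergy_one (hpos w h2)]
      have := hS w h1.le h2.le h3
      have h4 := jetEnergy_nonneg 1 u w
      have h5 := jetEnergy_nonneg 2 u w
      nlinarith)
    (fun w h1 h2 h3 => by
      refine (hu.heatOp_jetEnergy_two_le (hpos w h2)).trans ?_
      have h6 := hS w h1.le h2.le h3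
      have h4 := jetEnergy_nonneg 1 u w
      have h5 := jetEnergy_nonneg 2 u w
      have h7 : jetEnergy 1 u w ≤ L / r ^ 2 := by
        rw [le_div_iff₀ (by positivity)]; nlinarith [sq_nonneg r]
      have h8 : K₂ * (jetEnergy 1 u w * jetEnergy 2 u w) ≤ K₂ * L / r ^ 2 * jetEnergy 2 u w := by
        calc _ ≤ K₂ * (L / r ^ 2 * jetEnergy 2 u w) := by gcongr
          _ = _ := by ring
      have h9 : K₃ * jetEnergy 1 u w ^ 3 ≤ K₃ * S ^ 3 := by gcongr
      linarith)
  refine hb.trans ?_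
  have hS2 : S ^ 2 ≤ L * (S / r ^ 2) := by
    rw [mul_div_assoc', le_div_iff₀ (by positivity)]; nlinarith
  have hS3 : r ^ 2 * S ^ 3 ≤ L ^ 2 * (S / r ^ 2) := by
    rw [mul_div_assoc', le_div_iff₀ (by positivity)]
    calc r ^ 2 * S ^ 3 * r ^ 2 = (r ^ 2 * S) ^ 2 * S := by ring
      _ ≤ L ^ 2 * S := by gcongr
  calc (K₂ * L + 65 + 4 * n) * (S / r ^ 2 + 2 * S ^ 2) + r ^ 2 * (K₃ * S ^ 3)
      = (K₂ * L + 65 + 4 * n) * (S / r ^ 2 + 2 * S ^ 2) + K₃ * (r ^ 2 * S ^ 3) := by ring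
    _ ≤ (K₂ * L + 65 + 4 * n) * (S / r ^ 2 + 2 * (L * (S / r ^ 2)))
        + K₃ * (L ^ 2 * (S / r ^ 2)) := by gcongr
    _ = _ := by ring

/-- Backward Harnack inequality at the centre: barrier comparison forward in time. -/
theorem le_center_of_heatOp_le {f : Sp n × ℝ → ℝ} (hf : SmoothPos f) {z : Sp n × ℝ}
    {R s A B M : ℝ} (hR : 0 < R) (hs : 0 < s) (hsz : s ≤ z.2) (hA : 0 ≤ A) (hB : 0 ≤ B)
    (hint : ∀ w : Sp n × ℝ, dist w.1 z.1 < R → s < w.2 → w.2 ≤ z.2 → heatOp f w ≤ B)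
    (hlat : ∀ w : Sp n × ℝ, dist w.1 z.1 = R → s ≤ w.2 → w.2 ≤ z.2 → f w ≤ M + A * R ^ 2)
    (hbot : ∀ x : Sp n, dist x z.1 ≤ R → f (x, s) ≤ M + A * dist x z.1 ^ 2) :
    f z ≤ M + (B + 2 * n * A) * (z.2 - s) := by
  have hsq := smoothPos_sqDist (z₀ := z)
  have hF : SmoothPos (fun w : Sp n × ℝ => f w + (-A) * ∑ α : Fin n, (w.1 α - z.1 α) ^ 2) :=
    hf.add ((SmoothPos.const (-A)).mul hsq)
  have hheat : ∀ w : Sp n × ℝ, 0 < w.2 →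
      heatOp (fun w : Sp n × ℝ => f w + (-A) * ∑ α : Fin n, (w.1 α - z.1 α) ^ 2) w
        = heatOp f w + 2 * n * A := fun w hw => by
    rw [heatOp_add hf ((SmoothPos.const (-A)).mul hsq) hw, heatOp_const_mul _ hsq hw,
      heatOp_sqDist _ hw]
    ring
  have := le_of_heatOp_le hF (x₀ := z.1) (r := R) (t₁ := s) (t₀ := z.2) (B := B + 2 * n * A)
    (M := M) hs (by positivity)
    (fun w h1 h2 h3 => by rw [hheat w (hs.trans h2)]; linarith [hint w h1 h2 h3])
    (fun w h1 h2 h3 => by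
      have := hlat w h1 h2 h3
      rw [← dist_sq_eq_sum, h1]; linarith)
    (fun x h1 => by
      have := hbot x h1
      simp only [← dist_sq_eq_sum]; linarith)
    (z := z) (by simp [hR.le]) hsz le_rfl
  simpa [← dist_sq_eq_sum] using this

set_option maxHeartbeats 1000000 in
/-- If the energy density is comparable to its value at the top of a cylinder, then its integral
over the cylinder controls that value. -/
theorem exists_gradSq_le_integral_of_comparable (n k : ℕ) {Λ : ℝ} (hΛ : 1 ≤ Λ) : ∃ C : ℝ, 0 < C ∧
    ∀ u : Sp n × ℝ → Fin k → ℝ, SphereFlow u → ∀ (z : Sp n × ℝ) (ρ : ℝ), 0 < ρ → ρ ^ 2 < z.2 →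
      (∀ w : Sp n × ℝ, dist w.1 z.1 ≤ ρ → z.2 - ρ ^ 2 ≤ w.2 → w.2 ≤ z.2 →
        gradSq u w ≤ Λ * gradSq u z) →
      ρ ^ 2 * gradSq u z ≤ 1 →
        ρ ^ (n + 2) * gradSq u z ≤ C * ∫ w in pcyl z ρ, gradSq u w := by
  obtain ⟨C, hC1, hC⟩ := exists_jetEnergy_two_le n k (L := Λ) (by linarith)
  set κ : ℝ := 4 * Λ * C with hκ
  have hκ4 : 4 ≤ κ := by nlinarith
  set A₀ : ℝ := 4 * Λ + 2 * κ ^ 2 with hA₀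
  set B₀ : ℝ := 2 * Λ ^ 2 + 2 * n * A₀ with hB₀
  have hA₀0 : 0 < A₀ := by positivity
  have hB₀0 : 0 < B₀ := by positivity
  set θ : ℝ := (4 * κ + 8 * B₀)⁻¹ with hθ
  have hθ0 : 0 < θ := by positivity
  have hθκ : κ * θ ≤ 1 / 4 := by
    rw [hθ, ← div_eq_mul_inv, div_le_iff₀ (by positivity)]; linarith
  have hθB : B₀ * θ ≤ 1 / 8 := by
    rw [hθ, ← div_eq_mul_inv, div_le_iff₀ (by positivity)]; linarith
  have hθ2 : θ ≤ 1 / 2 := by nlinarith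
  refine ⟨2 / (ballVol n * θ ^ (n + 2)), by have := ballVol_pos n; positivity,
    fun u hu z ρ hρ hz hle hρa => ?_⟩
  have he := hu.smoothPos_gradSq
  have he0 : ∀ w, 0 ≤ gradSq u w := fun w => by
    rw [gradSq_eq_jetEnergy]; exact jetEnergy_nonneg 1 u w
  set a := gradSq u z with ha
  have ha0 : 0 ≤ a := he0 z
  have haρ : a ≤ 1 / ρ ^ 2 := by rw [le_div_iff₀ (by positivity)]; linarith
  have hzz : dist z.1 z.1 ≤ ρ / 2 := by rw [dist_self]; positivity
  have hE2 : ∀ w : Sp n × ℝ, dist w.1 z.1 ≤ ρ / 2 → z.2 - ρ ^ 2 / 4 ≤ w.2 → w.2 ≤ z.2 →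
      jetEnergy 2 u w ≤ C * (Λ * a / (ρ / 2) ^ 2) := by
    intro w h1 h2 h3
    refine hC u hu w (ρ / 2) (Λ * a) (by positivity) (by nlinarith) (fun y h4 h5 h6 => ?_)
      (by nlinarith)
    exact hle y (by linarith [dist_triangle y.1 w.1 z.1]) (by nlinarith) (by linarith)
  have hLip : ∀ x y s, dist x z.1 ≤ ρ / 2 → dist y z.1 ≤ ρ / 2 → z.2 - ρ ^ 2 / 4 ≤ s → s ≤ z.2 →
      |gradSq u (x, s) - gradSq u (y, s)| ≤ κ * a / ρ * dist x y := by
    intro x y s hx hy h1 h2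
    refine he.abs_sub_le (x₀ := z.1) (r := ρ / 2) (by nlinarith) (by positivity)
      (fun x hx => ?_) hx hy
    have h3 := sum_sq_dirDeriv_jetEnergy_le hu.smooth 1 (z := (x, s)) (by
      change 0 < s; nlinarith)
    rw [← gradSq_eq_jetEnergy] at h3
    refine h3.trans ?_
    have h4 := hE2 (x, s) hx h1 h2
    have h5 : gradSq u (x, s) ≤ Λ * a := hle (x, s) (by change dist x z.1 ≤ ρ; linarith)
      (by change _ ≤ s; nlinarith) h2
    calc 4 * gradSq u (x, s) * jetEnergy (1 + 1) u (x, s)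
        ≤ 4 * (Λ * a) * (C * (Λ * a / (ρ / 2) ^ 2)) := by
          gcongr
          exact jetEnergy_nonneg 2 u _
      _ = 16 * Λ ^ 2 * C * (a / ρ) ^ 2 := by field_simp; ring
      _ ≤ 16 * Λ ^ 2 * C ^ 2 * (a / ρ) ^ 2 := by gcongr; nlinarith
      _ = _ := by rw [hκ]; ring
  have htime : ∀ s, z.2 - θ * ρ ^ 2 ≤ s → s ≤ z.2 → 3 / 4 * a ≤ gradSq u (z.1, s) := by
    intro s h1 h2
    have hs4 : z.2 - ρ ^ 2 / 4 ≤ s := by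
      have : θ ≤ 1 / 4 := by nlinarith
      nlinarith [sq_nonneg ρ]
    have hs0 : 0 < s := by nlinarith
    have hlat : ∀ w : Sp n × ℝ, dist w.1 z.1 ≤ ρ / 2 → s ≤ w.2 → w.2 ≤ z.2 →
        gradSq u w ≤ Λ * a := fun w h3 h4 h5 => hle w (by linarith) (by nlinarith) h5
    have := le_center_of_heatOp_le he (z := z) (R := ρ / 2) (s := s) (A := A₀ * a / ρ ^ 2)
      (B := 2 * (Λ * a) ^ 2) (M := gradSq u (z.1, s) + a / 8) (by positivity) hs0 h2
      (by positivity) (by positivity)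
      (fun w h3 h4 h5 => by
        have h6 := hlat w h3.le h4.le h5
        have h7 := he0 w
        rw [gradSq_eq_jetEnergy] at h6 h7 ⊢
        rw [hu.heatOp_jetEnergy_one (hs0.trans h4)]
        have := jetEnergy_nonneg 2 u w
        nlinarith)
      (fun w h3 h4 h5 => by
        have h6 := hlat w h3.le h4 h5
        have h7 := he0 (z.1, s)
        have h8 : A₀ * a / ρ ^ 2 * (ρ / 2) ^ 2 = Λ * a + κ ^ 2 / 2 * a := by
          rw [hA₀]; field_simp; ring
        have h9 : 0 ≤ κ ^ 2 / 2 * a := by positivity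
        linarith)
      (fun x h3 => by
        have h4 := (abs_le.mp (hLip x z.1 s h3 hzz hs4 h2)).2
        have h5 : A₀ * a / ρ ^ 2 * dist x z.1 ^ 2 = 4 * Λ * a * (dist x z.1 / ρ) ^ 2
            + 2 * a * (κ * (dist x z.1 / ρ)) ^ 2 := by
          rw [hA₀]; field_simp
        have h6 : κ * a / ρ * dist x z.1 = a * (κ * (dist x z.1 / ρ)) := by ring
        have h7 : 0 ≤ 4 * Λ * a * (dist x z.1 / ρ) ^ 2 := by positivity
        have h8 : ∀ q : ℝ, a * q ≤ a / 8 + 2 * a * q ^ 2 := fun q => by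
          nlinarith [mul_nonneg ha0 (sq_nonneg (4 * q - 1))]
        have h9 := h8 (κ * (dist x z.1 / ρ))
        rw [h5]
        linarith)
    have h3 : (2 * (Λ * a) ^ 2 + 2 * n * (A₀ * a / ρ ^ 2)) * (z.2 - s) ≤ a / 8 := by
      calc (2 * (Λ * a) ^ 2 + 2 * n * (A₀ * a / ρ ^ 2)) * (z.2 - s)
          = a * (2 * Λ ^ 2 * a + 2 * n * (A₀ / ρ ^ 2)) * (z.2 - s) := by ring
        _ ≤ a * (2 * Λ ^ 2 * (1 / ρ ^ 2) + 2 * n * (A₀ / ρ ^ 2)) * (θ * ρ ^ 2) := by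
            gcongr
            linarith
        _ = a * (B₀ * θ) := by rw [hB₀]; field_simp
        _ ≤ a * (1 / 8) := by gcongr
        _ = _ := by ring
    linarith
  have hlow : ∀ w ∈ pcyl z (θ * ρ), a / 2 ≤ gradSq u w := by
    rintro ⟨x, s⟩ ⟨hx, hs1, hs2⟩
    have hx' : dist x z.1 ≤ θ * ρ := hx
    have h0 : z.2 - θ * ρ ^ 2 ≤ s := by
      have : z.2 - (θ * ρ) ^ 2 < s := hs1
      nlinarith [mul_nonneg hθ0.le (sq_nonneg ρ)]
    have h1 := htime s h0 hs2
    have hθ4 : θ ≤ 1 / 4 := by nlinarith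
    have h2 := (abs_le.mp (hLip x z.1 s (by nlinarith) hzz
      (by nlinarith [sq_nonneg ρ]) hs2)).1
    have h3 : κ * a / ρ * dist x z.1 ≤ a / 4 := by
      calc κ * a / ρ * dist x z.1 ≤ κ * a / ρ * (θ * ρ) := by gcongr
        _ = a * (κ * θ) := by field_simp
        _ ≤ a * (1 / 4) := by gcongr
        _ = _ := by ring
    linarith
  have := mul_ballVol_le_setIntegral he he0 (by positivity) (by nlinarith : θ * ρ ≤ ρ) hz hlow
  have hv := ballVol_pos n
  rw [div_mul_eq_mul_div, le_div_iff₀ (by positivity)]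
  calc ρ ^ (n + 2) * a * (ballVol n * θ ^ (n + 2))
      = 2 * (a / 2 * (ballVol n * (θ * ρ) ^ (n + 2))) := by rw [mul_pow]; ring
    _ ≤ _ := by gcongr

end Harnack

section PointSelection

variable {n k : ℕ}

theorem gradSq_nonneg (u : Sp n × ℝ → Fin k → ℝ) (z : Sp n × ℝ) : 0 ≤ gradSq u z :=
  Finset.sum_nonneg fun _ _ => Finset.sum_nonneg fun _ _ => sq_nonneg _

/-- Parabolic distance from `w` to the lateral and bottom boundary of the cylinder. -/
def boundaryDist (z : Sp n × ℝ) (r : ℝ) (w : Sp n × ℝ) : ℝ :=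
  min (r - dist w.1 z.1) (Real.sqrt (w.2 - z.2 + r ^ 2))

theorem continuous_boundaryDist (z : Sp n × ℝ) (r : ℝ) : Continuous (boundaryDist z r) := by
  unfold boundaryDist; fun_prop

/-- Either the energy density at the top centre of a cylinder is controlled by the energy on that
cylinder, or energy concentrates on a smaller cylinder. -/
theorem exists_gradSq_le_or_concentration (n k : ℕ) : ∃ C : ℝ, 1 ≤ C ∧
    ∀ u : Sp n × ℝ → Fin k → ℝ, SphereFlow u → ∀ (z : Sp n × ℝ) (r : ℝ), 0 < r → r ^ 2 < z.2 →
      r ^ (n + 2) * gradSq u z ≤ C * ∫ w in pcyl z r, gradSq u w ∨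
      ∃ (y : Sp n × ℝ) (ρ : ℝ), 0 < ρ ∧ ρ < r ∧ ρ ^ 2 < y.2 ∧ pcyl y ρ ⊆ pcyl z r ∧
        gradSq u y = 1 / ρ ^ 2 ∧ dist y.1 z.1 ≤ r ∧ z.2 - r ^ 2 ≤ y.2 ∧ y.2 ≤ z.2 ∧
        (∀ w ∈ pcyl y ρ, gradSq u w ≤ C / ρ ^ 2) ∧ ρ ^ n ≤ C * ∫ w in pcyl y ρ, gradSq u w := by
  have hΛ : (1 : ℝ) ≤ 2 ^ (n + 2) := one_le_pow₀ (by norm_num)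
  obtain ⟨C, hC0, hC⟩ := exists_gradSq_le_integral_of_comparable n k hΛ
  have hCC : C ≤ 2 ^ (n + 2) * (C + 1) := by nlinarith
  have hCΛ : (2 : ℝ) ^ (n + 2) ≤ 2 ^ (n + 2) * (C + 1) := by nlinarith
  refine ⟨2 ^ (n + 2) * (C + 1), by nlinarith, fun u hu z r hr hz => ?_⟩
  have he := hu.smoothPos_gradSq
  have he0 := gradSq_nonneg u
  set Q : Set (Sp n × ℝ) := closedBall z.1 r ×ˢ Icc (z.2 - r ^ 2) z.2 with hQ
  have hQc : IsCompact Q := (isCompact_closedBall _ _).prod isCompact_Icc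
  have hzQ : z ∈ Q := ⟨by simp [hr.le], by nlinarith, le_rfl⟩
  have hQpos : Q ⊆ {w : Sp n × ℝ | 0 < w.2} := fun w hw => by
    have := hw.2.1
    change 0 < w.2
    linarith
  obtain ⟨y, hyQ, hy⟩ := hQc.exists_isMaxOn ⟨z, hzQ⟩
    (f := fun w => boundaryDist z r w ^ (n + 2) * gradSq u w)
    (((continuous_boundaryDist z r).pow _).continuousOn.mul (he.continuousOn.mono hQpos))
  have hσz : boundaryDist z r z = r := by
    simp [boundaryDist, Real.sqrt_sq hr.le]
  have hmax : ∀ w ∈ Q, boundaryDist z r w ^ (n + 2) * gradSq u w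
      ≤ boundaryDist z r y ^ (n + 2) * gradSq u y := fun w hw => hy hw
  have hzmax := hmax z hzQ
  rw [hσz] at hzmax
  have hσ0 : 0 ≤ boundaryDist z r y :=
    le_min (by have : dist y.1 z.1 ≤ r := hyQ.1
               linarith) (Real.sqrt_nonneg _)
  set σ := boundaryDist z r y with hσ
  have hσ1 : σ ≤ r - dist y.1 z.1 := min_le_left _ _
  have hσ2 : σ ^ 2 ≤ y.2 - z.2 + r ^ 2 := by
    refine (Real.le_sqrt hσ0 ?_).mp (min_le_right _ _)
    linarith [hyQ.2.1]
  have hy2 : y.2 ≤ z.2 := hyQ.2.2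
  rcases hσ0.eq_or_lt with h0 | hσpos
  · left
    rw [← h0, zero_pow (by lia), zero_mul] at hzmax
    exact hzmax.trans (mul_nonneg (by positivity) (integral_nonneg he0))
  have hcomp : ∀ ρ ≤ σ / 2, 0 < ρ → ∀ w : Sp n × ℝ, dist w.1 y.1 ≤ ρ → y.2 - ρ ^ 2 ≤ w.2 →
      w.2 ≤ y.2 → gradSq u w ≤ 2 ^ (n + 2) * gradSq u y := by
    intro ρ hρ hρ0 w h1 h2 h3
    have hd : dist w.1 z.1 ≤ r - σ / 2 := by linarith [dist_triangle w.1 y.1 z.1]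
    have ht : (σ / 2) ^ 2 ≤ w.2 - z.2 + r ^ 2 := by nlinarith
    have hwQ : w ∈ Q := ⟨by change dist w.1 z.1 ≤ r; linarith, by nlinarith, by linarith⟩
    have hσw : σ / 2 ≤ boundaryDist z r w :=
      le_min (by linarith) (Real.le_sqrt_of_sq_le ht)
    have h4 : (σ / 2) ^ (n + 2) * gradSq u w ≤ σ ^ (n + 2) * gradSq u y :=
      (mul_le_mul_of_nonneg_right (pow_le_pow_left₀ (by positivity) hσw _) (he0 w)).trans
        (hmax w hwQ)
    have h5 : σ ^ (n + 2) = (σ / 2) ^ (n + 2) * 2 ^ (n + 2) := by rw [← mul_pow]; congr 1; ring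
    rw [h5, mul_assoc] at h4
    exact le_of_mul_le_mul_left h4 (by positivity)
  have hsub : ∀ ρ ≤ σ / 2, 0 < ρ → pcyl y ρ ⊆ pcyl z r := by
    intro ρ hρ hρ0 w hw
    have h1 : dist w.1 y.1 ≤ ρ := hw.1
    have h2 : y.2 - ρ ^ 2 < w.2 := hw.2.1
    have h3 : w.2 ≤ y.2 := hw.2.2
    exact ⟨by change dist w.1 z.1 ≤ r; linarith [dist_triangle w.1 y.1 z.1], by nlinarith,
      by linarith⟩
  by_cases hcase : (σ / 2) ^ 2 * gradSq u y ≤ 1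
  · left
    have h1 := hC u hu y (σ / 2) (by positivity) (by nlinarith) (hcomp _ le_rfl (by positivity))
      hcase
    have h2 : ∫ w in pcyl y (σ / 2), gradSq u w ≤ ∫ w in pcyl z r, gradSq u w :=
      setIntegral_mono_set (he.continuousOn.integrableOn_pcyl hz) (ae_of_all _ he0)
        (hsub _ le_rfl (by positivity)).eventuallyLE
    have h3 : σ ^ (n + 2) = 2 ^ (n + 2) * (σ / 2) ^ (n + 2) := by rw [← mul_pow]; congr 1; ring
    have h4 : 0 ≤ ∫ w in pcyl z r, gradSq u w := integral_nonneg he0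
    calc r ^ (n + 2) * gradSq u z ≤ 2 ^ (n + 2) * ((σ / 2) ^ (n + 2) * gradSq u y) := by
          rw [← mul_assoc, ← h3]; exact hzmax
      _ ≤ 2 ^ (n + 2) * ((C + 1) * ∫ w in pcyl z r, gradSq u w) := by
          refine mul_le_mul_of_nonneg_left (h1.trans ?_) (by positivity)
          exact mul_le_mul (by linarith) h2 (integral_nonneg he0) (by linarith)
      _ = _ := by ring
  · right
    push Not at hcase
    have ha : 0 < gradSq u y := by
      by_contra! h
      nlinarith [sq_nonneg (σ / 2)]
    set ρ : ℝ := (Real.sqrt (gradSq u y))⁻¹ with hρ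
    have hρ0 : 0 < ρ := inv_pos.mpr (Real.sqrt_pos.mpr ha)
    have hρ2 : ρ ^ 2 = (gradSq u y)⁻¹ := by rw [hρ, inv_pow, Real.sq_sqrt ha.le]
    have hρa : ρ ^ 2 * gradSq u y = 1 := by rw [hρ2]; exact inv_mul_cancel₀ ha.ne'
    have hρσ : ρ ≤ σ / 2 := by
      refine le_of_sq_le_sq ?_ (by positivity)
      rw [← hρa] at hcase
      exact (lt_of_mul_lt_mul_right hcase ha.le).le
    have ha' : gradSq u y = 1 / ρ ^ 2 := by rw [hρ2]; simp
    have h1 := hC u hu y ρ hρ0 (by nlinarith) (hcomp ρ hρσ hρ0) hρa.le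
    have h4 : 0 ≤ ∫ w in pcyl y ρ, gradSq u w := integral_nonneg he0
    refine ⟨y, ρ, hρ0, ?_, by nlinarith, hsub ρ hρσ hρ0, ha', hyQ.1, hyQ.2.1, hyQ.2.2,
      fun w hw => ?_, ?_⟩
    · linarith [dist_nonneg (x := y.1) (y := z.1)]
    · refine (hcomp ρ hρσ hρ0 w hw.1 hw.2.1.le hw.2.2).trans ?_
      rw [ha', mul_one_div]
      gcongr
    · calc ρ ^ n = ρ ^ (n + 2) * gradSq u y := by rw [pow_add, mul_assoc, hρa, mul_one]
        _ ≤ _ := h1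
        _ ≤ _ := mul_le_mul_of_nonneg_right hCC h4

end PointSelection

section Concentration

variable {n k : ℕ} {u : Sp n × ℝ → Fin k → ℝ}

theorem MorreySmall.setIntegral_le {p R ε : ℝ} (hp : 1 ≤ p) (hε : 0 ≤ ε) (hε1 : ε ≤ 1)
    (h : MorreySmall u p R ε) {z : Sp n × ℝ} {r : ℝ} (hr : 0 < r) (hrR : r < R) (hz : r ^ 2 < z.2) :
    r ^ (p - n - 2) * ∫ w in pcyl z r, gradSq u w ^ (p / 2) ≤ ε := by
  obtain ⟨A, B, hAB, hA, hB⟩ := h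
  have hzpos : 0 < z.2 := lt_of_le_of_lt (sq_nonneg r) hz
  have hlt : r < min R (Real.sqrt z.2) := lt_min hrR ((Real.lt_sqrt hr.le).mpr hz)
  have hA' := hA z.1 z.2 r hzpos hr hlt
  have hB' := hB z.1 z.2 r hzpos hr hlt
  have hB0 : 0 ≤ B := le_trans (Real.rpow_nonneg (mul_nonneg (Real.rpow_nonneg hr.le _)
    (integral_nonneg fun w => Real.rpow_nonneg
      (Finset.sum_nonneg fun _ _ => sq_nonneg _) _)) _) hB'
  set J := r ^ (p - n - 2) * ∫ w in pcyl z r, gradSq u w ^ (p / 2) with hJ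
  have hJ0 : 0 ≤ J := mul_nonneg (Real.rpow_nonneg hr.le _)
    (integral_nonneg fun w => Real.rpow_nonneg (gradSq_nonneg u w) _)
  have h1 : J ^ (1 / p) ≤ ε := hA'.trans (by linarith)
  have hp0 : 0 < p := by linarith
  calc J = (J ^ (1 / p)) ^ p := by
        rw [← Real.rpow_mul hJ0, one_div_mul_cancel hp0.ne', Real.rpow_one]
    _ ≤ ε ^ p := Real.rpow_le_rpow (Real.rpow_nonneg hJ0 _) h1 hp0.le
    _ ≤ ε := by simpa using Real.rpow_le_rpow_of_exponent_ge' hε hε1 zero_le_one hp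

/-- Morrey smallness excludes concentration of the energy at scales below the Morrey scale. -/
theorem MorreySmall.le_of_concentration {p R C : ℝ} (hu : SphereFlow u) (hp1 : 1 ≤ p) (hp2 : p ≤ 2)
    (hC : 1 ≤ C) (h : MorreySmall u p R (1 / (2 * C ^ 2))) {y : Sp n × ℝ} {ρ : ℝ}
    (hρ : 0 < ρ) (hy : ρ ^ 2 < y.2) (hb : ∀ w ∈ pcyl y ρ, gradSq u w ≤ C / ρ ^ 2)
    (hc : ρ ^ n ≤ C * ∫ w in pcyl y ρ, gradSq u w) : R ≤ ρ := by
  by_contra! hlt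
  have hε1 : 1 / (2 * C ^ 2) ≤ 1 := by
    rw [div_le_one (by positivity)]; nlinarith
  have hM := h.setIntegral_le hp1 (by positivity) hε1 hρ hlt hy
  have he := hu.smoothPos_gradSq
  have hint1 : IntegrableOn (gradSq u) (pcyl y ρ) := he.continuousOn.integrableOn_pcyl hy
  have hint2 : IntegrableOn (fun w => gradSq u w ^ (p / 2)) (pcyl y ρ) :=
    (he.continuousOn.rpow_const fun w _ => Or.inr (by linarith)).integrableOn_pcyl hy
  have hpt : ∀ w ∈ pcyl y ρ, gradSq u w ≤ C * ρ ^ (p - 2) * gradSq u w ^ (p / 2) := by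
    intro w hw
    have h0 := gradSq_nonneg u w
    have hq : 0 ≤ 1 - p / 2 := by linarith
    have h1 : gradSq u w = gradSq u w ^ (1 - p / 2) * gradSq u w ^ (p / 2) := by
      rw [← Real.rpow_add_of_nonneg h0 hq (by linarith), sub_add_cancel, Real.rpow_one]
    have h2 : gradSq u w ^ (1 - p / 2) ≤ C * ρ ^ (p - 2) := by
      calc gradSq u w ^ (1 - p / 2) ≤ (C / ρ ^ 2) ^ (1 - p / 2) :=
            Real.rpow_le_rpow h0 (hb w hw) hq
        _ = C ^ (1 - p / 2) * ρ ^ (p - 2) := by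
            rw [Real.div_rpow (by linarith) (by positivity), ← Real.rpow_natCast ρ 2,
              ← Real.rpow_mul hρ.le, div_eq_mul_inv, ← Real.rpow_neg hρ.le]
            congr 2; push_cast; ring
        _ ≤ C * ρ ^ (p - 2) := by
            gcongr
            simpa using Real.rpow_le_rpow_of_exponent_le hC (show 1 - p / 2 ≤ 1 by linarith)
    calc gradSq u w = gradSq u w ^ (1 - p / 2) * gradSq u w ^ (p / 2) := h1
      _ ≤ _ := by gcongr
  have hI : ∫ w in pcyl y ρ, gradSq u w
      ≤ C * ρ ^ (p - 2) * ∫ w in pcyl y ρ, gradSq u w ^ (p / 2) := by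
    rw [← integral_const_mul]
    exact setIntegral_mono_on hint1 (hint2.const_mul _) measurableSet_pcyl hpt
  have hsplit : ρ ^ (p - 2) = ρ ^ n * ρ ^ (p - n - 2) := by
    rw [← Real.rpow_natCast, ← Real.rpow_add hρ]; congr 1; ring
  rw [hsplit] at hI
  have hρn : 0 < ρ ^ n := by positivity
  have : ρ ^ n ≤ ρ ^ n * (1 / 2) := by
    calc ρ ^ n ≤ C * ∫ w in pcyl y ρ, gradSq u w := hc
      _ ≤ C * (C * ρ ^ n * (1 / (2 * C ^ 2))) := by
          gcongr
          refine hI.trans ?_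
          rw [show ∀ a b c : ℝ, C * (a * b) * c = C * a * (b * c) by intros; ring]
          gcongr
      _ = ρ ^ n * (1 / 2) := by field_simp
  linarith

/-- Energy in the spacetime region after time `s`. -/
def tailEnergy (u : Sp n × ℝ → Fin k → ℝ) (s : ℝ) : ℝ :=
  ∫ z in {z : Sp n × ℝ | s < z.2}, gradSq u z

theorem tendsto_tailEnergy (h : IntegrableOn (gradSq u) {z : Sp n × ℝ | 0 < z.2}) :
    Tendsto (tailEnergy u) atTop (nhds 0) := by
  have hm : ∀ s : ℝ, MeasurableSet {z : Sp n × ℝ | s < z.2} := fun s =>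
    measurableSet_lt measurable_const measurable_snd
  have := tendsto_setIntegral_of_antitone (μ := volume) (f := gradSq u)
    (s := fun s : ℝ => {z : Sp n × ℝ | s < z.2}) hm
    (fun a b hab z (hz : b < z.2) => lt_of_le_of_lt hab hz) ⟨0, h⟩
  have hempty : ⋂ s : ℝ, {z : Sp n × ℝ | s < z.2} = ∅ := by
    ext z
    simp only [mem_iInter, mem_ofPred_eq, mem_empty_iff_false, iff_false, not_forall]
    exact ⟨z.2, lt_irrefl _⟩
  rw [hempty, setIntegral_empty] at this
  exact this

theorem setIntegral_pcyl_le_tailEnergy (h : IntegrableOn (gradSq u) {z : Sp n × ℝ | 0 < z.2})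
    {z : Sp n × ℝ} {r s : ℝ} (hs0 : 0 ≤ s) (hs : s ≤ z.2 - r ^ 2) :
    ∫ w in pcyl z r, gradSq u w ≤ tailEnergy u s := by
  refine setIntegral_mono_set (h.mono_set fun w (hw : s < w.2) => lt_of_le_of_lt hs0 hw)
    (ae_of_all _ fun w => gradSq_nonneg u w) (ae_of_all _ fun w hw => ?_)
  exact lt_of_le_of_lt hs hw.2.1

theorem exists_gradSq_le_integral_of_morreySmall (n k : ℕ) :
    ∃ C : ℝ, 1 ≤ C ∧ ∀ u : Sp n × ℝ → Fin k → ℝ, SphereFlow u →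
      IntegrableOn (gradSq u) {z : Sp n × ℝ | 0 < z.2} → ∀ p : ℝ, 1 ≤ p → p ≤ 2 →
      MorreySmall u p 1 (1 / (2 * C ^ 2)) → ∃ T : ℝ, 2 ≤ T ∧ ∀ z : Sp n × ℝ, T ≤ z.2 →
        ∀ r : ℝ, 0 < r → r ^ 2 ≤ z.2 / 2 →
          r ^ (n + 2) * gradSq u z ≤ C * ∫ w in pcyl z r, gradSq u w := by
  obtain ⟨C, hC1, hC⟩ := exists_gradSq_le_or_concentration n k
  refine ⟨C, hC1, fun u hu hint p hp1 hp2 hM => ?_⟩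
  have ht := tendsto_tailEnergy hint
  obtain ⟨T, hT⟩ := eventually_atTop.mp
    (ht.eventually_lt_const (show (0 : ℝ) < 1 / C by positivity))
  refine ⟨max 2 (2 * T), le_max_left _ _, fun z hz r hr hrz => ?_⟩
  have hz2 : 2 ≤ z.2 := (le_max_left _ _).trans hz
  have hzT : 2 * T ≤ z.2 := (le_max_right _ _).trans hz
  rcases hC u hu z r hr (by linarith) with h | ⟨y, ρ, hρ, hρr, hρy, hsub, -, -, -, -, hb, hc⟩
  · exact h
  · exfalso
    have hρ1 := hM.le_of_concentration hu hp1 hp2 hC1 hρ hρy hb hc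
    have h1 : (1 : ℝ) ≤ ρ ^ n := one_le_pow₀ hρ1
    have h2 : ∫ w in pcyl y ρ, gradSq u w ≤ ∫ w in pcyl z r, gradSq u w :=
      setIntegral_mono_set (hu.smoothPos_gradSq.continuousOn.integrableOn_pcyl (by linarith))
        (ae_of_all _ fun w => gradSq_nonneg u w) (ae_of_all _ fun w hw => hsub hw)
    have h3 := setIntegral_pcyl_le_tailEnergy hint (z := z) (r := r) (s := z.2 / 2) (by linarith)
      (by linarith)
    have h4 : tailEnergy u (z.2 / 2) < 1 / C := hT _ (by linarith)
    have h5 : C * ∫ w in pcyl y ρ, gradSq u w < 1 := by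
      calc _ < C * (1 / C) := by gcongr; linarith
        _ = 1 := by field_simp
    linarith

end Concentration

section Decay

variable {n k : ℕ} {u : Sp n × ℝ → Fin k → ℝ}

theorem measurable_gradSq (u : Sp n × ℝ → Fin k → ℝ) : Measurable (gradSq u) :=
  Finset.measurable_sum _ fun _ _ => Finset.measurable_sum _ fun _ _ =>
    (measurable_fderiv_apply_const ℝ _ _).pow_const 2

/-- A pointwise bound by the energy on unit cylinders bounds the energy of a time slice. -/
theorem integral_slice_le_tailEnergy (h : IntegrableOn (gradSq u) {z : Sp n × ℝ | 0 < z.2})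
    {C t : ℝ} (hC : 0 ≤ C) (ht : 1 ≤ t)
    (hb : ∀ x : Sp n, gradSq u (x, t) ≤ C * ∫ w in pcyl (x, t) 1, gradSq u w) :
    ∫ x : Sp n, gradSq u (x, t) ≤ C * (ballVol n * tailEnergy u (t - 1)) := by
  have he0 := gradSq_nonneg u
  have hem := measurable_gradSq u
  have hG0 : 0 ≤ tailEnergy u (t - 1) := integral_nonneg he0
  have hV := (ballVol_pos n).le
  have htail : IntegrableOn (gradSq u) {z : Sp n × ℝ | t - 1 < z.2} :=
    h.mono_set fun w (hw : t - 1 < w.2) => show 0 < w.2 by linarith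
  set S : Set (Sp n × (Sp n × ℝ)) := {q | dist q.2.1 q.1 ≤ 1 ∧ t - 1 < q.2.2 ∧ q.2.2 ≤ t} with hS
  have hSm : MeasurableSet S := by
    have h1 : Measurable fun q : Sp n × (Sp n × ℝ) => dist q.2.1 q.1 := by fun_prop
    have h2 : Measurable fun q : Sp n × (Sp n × ℝ) => q.2.2 := by fun_prop
    exact (measurableSet_le h1 measurable_const).inter
      ((measurableSet_lt measurable_const h2).inter (measurableSet_le h2 measurable_const))
  set F : Sp n → Sp n × ℝ → ENNReal := fun x w =>
    S.indicator (fun q => ENNReal.ofReal (gradSq u q.2)) (x, w) with hF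
  have hFm : Measurable (Function.uncurry F) :=
    (hem.comp measurable_snd).ennreal_ofReal.indicator hSm
  have hx : ∀ x, ENNReal.ofReal (gradSq u (x, t)) ≤ ENNReal.ofReal C * ∫⁻ w, F x w := by
    intro x
    have h1 : IntegrableOn (gradSq u) (pcyl (x, t) 1) := h.mono_set fun w hw => by
      have := hw.2.1
      change 0 < w.2
      simp only [one_pow] at this
      linarith
    have h2 : ∫⁻ w, F x w = ENNReal.ofReal (∫ w in pcyl (x, t) 1, gradSq u w) := by
      rw [ofReal_integral_eq_lintegral_ofReal h1 (ae_of_all _ he0),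
        ← lintegral_indicator measurableSet_pcyl]
      refine lintegral_congr fun w => ?_
      have : (x, w) ∈ S ↔ w ∈ pcyl (x, t) 1 := by
        simp [hS, pcyl, Set.mem_prod]
      by_cases hw : w ∈ pcyl (x, t) 1
      · simp only [hF, indicator_of_mem hw, indicator_of_mem (this.mpr hw)]
      · simp only [hF, indicator_of_notMem hw, indicator_of_notMem (mt this.mp hw)]
    rw [h2, ← ENNReal.ofReal_mul hC]
    exact ENNReal.ofReal_le_ofReal (hb x)
  have hw : ∀ w : Sp n × ℝ, ∫⁻ x, F x w ≤ ENNReal.ofReal (ballVol n) *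
      {z : Sp n × ℝ | t - 1 < z.2}.indicator (fun z => ENNReal.ofReal (gradSq u z)) w := by
    intro w
    by_cases hwt : t - 1 < w.2
    · rw [indicator_of_mem (show w ∈ {z : Sp n × ℝ | t - 1 < z.2} from hwt)]
      calc ∫⁻ x, F x w
          ≤ ∫⁻ x, (closedBall w.1 1).indicator (fun _ => ENNReal.ofReal (gradSq u w)) x := by
            refine lintegral_mono fun x => ?_
            by_cases hxS : (x, w) ∈ S
            · have : x ∈ closedBall w.1 1 := by
                rw [mem_closedBall, dist_comm]; exact hxS.1
              simp only [hF, indicator_of_mem hxS, indicator_of_mem this, le_refl]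
            · simp only [hF, indicator_of_notMem hxS, zero_le]
        _ = ENNReal.ofReal (gradSq u w) * volume (closedBall w.1 1) := by
            rw [lintegral_indicator_const measurableSet_closedBall]
        _ = _ := by
            rw [mul_comm, Measure.addHaar_closedBall _ _ zero_le_one, ballVol, Measure.real,
              ENNReal.ofReal_toReal measure_ball_lt_top.ne]
            simp
    · have : ∀ x, F x w = 0 := fun x => indicator_of_notMem (fun hm => hwt hm.2.1) _
      simp [this]
  have key : ∫⁻ x, ENNReal.ofReal (gradSq u (x, t))
      ≤ ENNReal.ofReal (C * (ballVol n * tailEnergy u (t - 1))) := by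
    calc ∫⁻ x, ENNReal.ofReal (gradSq u (x, t))
        ≤ ∫⁻ x, ENNReal.ofReal C * ∫⁻ w, F x w := lintegral_mono hx
      _ = ENNReal.ofReal C * ∫⁻ w, ∫⁻ x, F x w := by
          rw [lintegral_const_mul' _ _ ENNReal.ofReal_ne_top,
            lintegral_lintegral_swap hFm.aemeasurable]
      _ ≤ ENNReal.ofReal C * ∫⁻ w, ENNReal.ofReal (ballVol n) *
            {z : Sp n × ℝ | t - 1 < z.2}.indicator (fun z => ENNReal.ofReal (gradSq u z)) w := by
          gcongr with w
          exact hw w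
      _ = _ := by
          rw [lintegral_const_mul' _ _ ENNReal.ofReal_ne_top,
            lintegral_indicator (measurableSet_lt measurable_const measurable_snd),
            ← ofReal_integral_eq_lintegral_ofReal htail (ae_of_all _ he0), ENNReal.ofReal_mul hC,
            ENNReal.ofReal_mul hV]
          rfl
  rw [integral_eq_lintegral_of_nonneg_ae (ae_of_all _ fun x => he0 (x, t))
    (hem.comp measurable_prodMk_right).aestronglyMeasurable]
  exact ENNReal.toReal_le_of_le_ofReal (by positivity) key

/-- If energy densities are controlled by energies on all cylinders, the energy density decays
quadratically. -/
theorem exists_gradSq_le_div_sq (hn : 2 ≤ n) (h : IntegrableOn (gradSq u) {z : Sp n × ℝ | 0 < z.2})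
    {C T : ℝ} (hC : 1 ≤ C) (hT : 2 ≤ T)
    (hb : ∀ z : Sp n × ℝ, T ≤ z.2 → ∀ r : ℝ, 0 < r → r ^ 2 ≤ z.2 / 2 →
      r ^ (n + 2) * gradSq u z ≤ C * ∫ w in pcyl z r, gradSq u w) :
    ∃ M : ℝ, 0 ≤ M ∧ ∀ z : Sp n × ℝ, T ≤ z.2 → gradSq u z ≤ M / z.2 ^ 2 := by
  have hG0 : 0 ≤ tailEnergy u 0 := integral_nonneg (gradSq_nonneg u)
  refine ⟨4 * C * tailEnergy u 0, by positivity, fun z hz => ?_⟩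
  have hz0 : 2 ≤ z.2 := hT.trans hz
  have hr2 : Real.sqrt (z.2 / 2) ^ 2 = z.2 / 2 := Real.sq_sqrt (by linarith)
  have hr1 : 1 ≤ Real.sqrt (z.2 / 2) := Real.one_le_sqrt.mpr (by linarith)
  have h1 := hb z hz (Real.sqrt (z.2 / 2)) (by linarith) hr2.le
  have h2 := setIntegral_pcyl_le_tailEnergy h (z := z) (r := Real.sqrt (z.2 / 2)) le_rfl
    (by rw [hr2]; linarith)
  have h3 : z.2 ^ 2 / 4 ≤ Real.sqrt (z.2 / 2) ^ (n + 2) := by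
    calc z.2 ^ 2 / 4 = Real.sqrt (z.2 / 2) ^ 4 := by
          rw [show 4 = 2 * 2 from rfl, pow_mul, hr2]; ring
      _ ≤ _ := pow_le_pow_right₀ hr1 (by lia)
  rw [le_div_iff₀ (by positivity)]
  have h4 : z.2 ^ 2 / 4 * gradSq u z ≤ C * tailEnergy u 0 := by
    calc z.2 ^ 2 / 4 * gradSq u z ≤ Real.sqrt (z.2 / 2) ^ (n + 2) * gradSq u z := by
          gcongr; exact gradSq_nonneg u z
      _ ≤ C * ∫ w in pcyl z (Real.sqrt (z.2 / 2)), gradSq u w := h1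
      _ ≤ _ := by gcongr
  linarith

/-- Quadratic decay of the energy density gives cubic decay of the Hessian. -/
theorem SphereFlow.exists_jetEnergy_two_le_div_cube (hu : SphereFlow u) {M T : ℝ} (hM : 0 ≤ M)
    (hT : 2 ≤ T) (h : ∀ z : Sp n × ℝ, T ≤ z.2 → gradSq u z ≤ M / z.2 ^ 2) :
    ∃ M' : ℝ, 0 ≤ M' ∧ ∀ z : Sp n × ℝ, 2 * T ≤ z.2 → jetEnergy 2 u z ≤ M' / z.2 ^ 3 := by
  obtain ⟨C, hC1, hC⟩ := exists_jetEnergy_two_le n k (L := M) hM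
  refine ⟨16 * C * M, by positivity, fun z hz => ?_⟩
  have hz4 : 4 ≤ z.2 := by linarith
  have hr2 : (Real.sqrt z.2 / 2) ^ 2 = z.2 / 4 := by
    rw [div_pow, Real.sq_sqrt (by linarith)]; norm_num
  have hr0 : 0 < Real.sqrt z.2 / 2 := by
    have := Real.sqrt_pos.mpr (show 0 < z.2 by linarith)
    linarith
  have := hC u hu z (Real.sqrt z.2 / 2) (4 * M / z.2 ^ 2) hr0 (by rw [hr2]; linarith)
    (fun w _ hw1 hw2 => ?_) ?_
  · refine this.trans (le_of_eq ?_)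
    rw [hr2]
    have : z.2 ≠ 0 := by linarith
    field_simp
    ring
  · rw [hr2] at hw1
    refine (h w (by linarith)).trans ?_
    have hw : z.2 / 2 ≤ w.2 := by linarith
    rw [div_le_div_iff₀ (by have : 0 < w.2 := by linarith
                            positivity) (by positivity)]
    nlinarith [mul_le_mul_of_nonneg_left (pow_le_pow_left₀ (by linarith) hw 2) hM]
  · rw [hr2]
    have hz0 : z.2 ≠ 0 := by linarith
    rw [show z.2 / 4 * (4 * M / z.2 ^ 2) = M / z.2 by field_simp]
    exact div_le_self hM (by linarith)

end Decay

section Convergence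

variable {n k : ℕ} {u : Sp n × ℝ → Fin k → ℝ}

theorem SphereFlow.abs_dirDeriv_tdir_le (hu : SphereFlow u) {z : Sp n × ℝ} (hz : 0 < z.2)
    (i : Fin k) : |dirDeriv (tdir n) (fun w => u w i) z| ≤ jetSize 2 u z + gradSq u z := by
  have h1 := hu.flow z hz i
  have h2 : |u z i| ≤ 1 := by
    rw [← sq_le_one_iff_abs_le_one, ← hu.sphere z hz]
    exact Finset.single_le_sum (f := fun i => u z i ^ 2) (fun _ _ => sq_nonneg _)
      (Finset.mem_univ i)
  have h3 : |∑ α : Fin n, dirDeriv (sdir n α) (dirDeriv (sdir n α) (fun w => u w i)) z|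
      ≤ jetNorm 2 (fun w => u w i) z := by
    refine (Finset.abs_sum_le_sum_abs _ _).trans (Finset.sum_le_sum fun α _ => ?_)
    exact Finset.single_le_sum
      (f := fun β => jetNorm 0 (dirDeriv (sdir n β) (dirDeriv (sdir n α) (fun w => u w i))) z)
      (fun β _ => jetNorm_nonneg 0 _) (Finset.mem_univ α)
  have h4 : |gradSq u z * u z i| ≤ gradSq u z := by
    rw [abs_mul, abs_of_nonneg (gradSq_nonneg u z)]
    exact mul_le_of_le_one_right (gradSq_nonneg u z) h2
  rw [heatOp, sub_eq_iff_eq_add] at h1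
  rw [h1]
  refine (abs_add_le _ _).trans ?_
  have := h3.trans (jetNorm_le_jetSize 2 i)
  linarith

/-- Decay of the energy density and of the Hessian makes the time derivative integrable, so that
the flow converges at every point. -/
theorem SphereFlow.exists_tendsto (hu : SphereFlow u) {M M' T : ℝ} (hM : 0 ≤ M) (hM' : 0 ≤ M')
    (hT : 1 ≤ T) (h1 : ∀ z : Sp n × ℝ, T ≤ z.2 → gradSq u z ≤ M / z.2 ^ 2)
    (h2 : ∀ z : Sp n × ℝ, T ≤ z.2 → jetEnergy 2 u z ≤ M' / z.2 ^ 3) (x : Sp n) (i : Fin k) :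
    ∃ c : ℝ, Tendsto (fun t => u (x, t) i) atTop (nhds c) := by
  have hpos : ∀ t ∈ Ioi T, 0 < t := fun t ht => by linarith [mem_Ioi.mp ht]
  refine ⟨_, tendsto_limUnder_of_hasDerivAt_of_integrableOn_Ioi (a := T)
    (f' := fun t => dirDeriv (tdir n) (fun w => u w i) (x, t)) (fun t ht => ?_) ?_⟩
  · have hd := ((hu.smooth i).differentiableAt (z := (x, t)) (hpos t ht)).hasFDerivAt
    exact hd.comp_hasDerivAt t ((hasDerivAt_const t x).prodMk (hasDerivAt_id t))
  · have hint : IntegrableOn (fun t : ℝ => (Real.sqrt (k * n ^ 2 * M') + M) * t ^ (-(3 / 2) : ℝ))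
        (Ioi T) :=
      (integrableOn_Ioi_rpow_of_lt (by norm_num) (by linarith)).const_mul _
    refine Integrable.mono' hint ?_ ?_
    · refine ContinuousOn.aestronglyMeasurable ?_ measurableSet_Ioi
      exact ((hu.smooth i).dirDeriv _).continuousOn.comp (by fun_prop) fun t ht => hpos t ht
    · refine (ae_restrict_iff' measurableSet_Ioi).mpr (ae_of_all _ fun t ht => ?_)
      have ht0 := hpos t ht
      have hTt : T ≤ t := (mem_Ioi.mp ht).le
      refine (hu.abs_dirDeriv_tdir_le (z := (x, t)) ht0 i).trans ?_
      rw [add_mul]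
      have hsq : (t ^ (-(3 / 2) : ℝ)) ^ 2 = (t ^ 3)⁻¹ := by
        rw [← Real.rpow_natCast, ← Real.rpow_mul ht0.le, ← Real.rpow_natCast,
          ← Real.rpow_neg ht0.le]
        norm_num
      have hr0 := Real.rpow_nonneg ht0.le (-(3 / 2) : ℝ)
      refine add_le_add ?_ ?_
      · refine le_of_sq_le_sq ?_ (by positivity)
        rw [mul_pow, Real.sq_sqrt (by positivity), hsq]
        refine (jetSize_sq_le 2).trans ?_
        calc k * n ^ 2 * jetEnergy 2 u (x, t) ≤ k * n ^ 2 * (M' / t ^ 3) := by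
              gcongr; exact h2 (x, t) hTt
          _ = _ := by ring
      · refine (h1 (x, t) hTt).trans ?_
        rw [div_eq_mul_inv]
        gcongr
        rw [← Real.rpow_natCast, ← Real.rpow_neg ht0.le]
        exact Real.rpow_le_rpow_of_exponent_le (by linarith) (by norm_num)

/-- Uniform decay of the first derivatives propagates to all higher derivatives. -/
theorem SphereFlow.exists_jetSize_le (hu : SphereFlow u) {M T : ℝ} (hT : 1 ≤ T)
    (h1 : ∀ z : Sp n × ℝ, T ≤ z.2 → gradSq u z ≤ M / z.2 ^ 2) (m : ℕ) :
    ∀ δ > 0, ∃ T' : ℝ, 1 ≤ T' ∧ ∀ z : Sp n × ℝ, T' ≤ z.2 →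
      ∀ j, 1 ≤ j → j ≤ m + 1 → jetSize j u z ≤ δ := by
  induction m with
  | zero =>
    intro δ hδ
    refine ⟨max T (k * n * M / δ ^ 2), hT.trans (le_max_left _ _), fun z hz j hj1 hj2 => ?_⟩
    obtain rfl : j = 1 := by lia
    have hzT := (le_max_left _ _).trans hz
    have hzM := (le_max_right _ _).trans hz
    have hz1 : 1 ≤ z.2 := hT.trans hzT
    refine le_of_sq_le_sq ?_ hδ.le
    rw [div_le_iff₀ (by positivity)] at hzM
    calc jetSize 1 u z ^ 2 ≤ k * n ^ 1 * jetEnergy 1 u z := jetSize_sq_le 1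
      _ ≤ k * n ^ 1 * (M / z.2 ^ 2) := by
          gcongr; rw [← gradSq_eq_jetEnergy]; exact h1 z hzT
      _ ≤ δ ^ 2 := by
          rw [mul_div_assoc', div_le_iff₀ (by positivity)]
          nlinarith [mul_nonneg (mul_nonneg (sq_nonneg δ) (by linarith : 0 ≤ z.2))
            (by linarith : 0 ≤ z.2 - 1)]
  | succ m ih =>
    intro δ hδ
    obtain ⟨C, hC0, hC⟩ := exists_heatOp_jetEnergy_le n k (m := m + 1) (by lia)
    obtain ⟨D, hD0, hD⟩ := exists_heatOp_jetEnergy_le n k (m := m + 2) (by lia)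
    set A : ℝ := (D + 65 + 4 * n) * (1 + 2 * C) + D with hA
    set G : ℝ := k * n ^ (m + 2) * A with hG
    have hG0 : 0 ≤ G := by positivity
    set η : ℝ := min 1 (min δ (δ ^ 2 / (G + 1))) with hη
    have hη0 : 0 < η := by positivity
    have hη1 : η ≤ 1 := min_le_left _ _
    have hηδ : η ≤ δ := (min_le_right _ _).trans (min_le_left _ _)
    have hηG : G * η ≤ δ ^ 2 := by
      have : η ≤ δ ^ 2 / (G + 1) := (min_le_right _ _).trans (min_le_right _ _)
      rw [le_div_iff₀ (by positivity)] at this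
      nlinarith
    obtain ⟨S, hS1, hS⟩ := ih η hη0
    refine ⟨S + 1, by linarith, fun z hz j hj1 hj2 => ?_⟩
    rcases hj2.lt_or_eq with hlt | rfl
    · exact (hS z (by linarith) j hj1 (by lia)).trans hηδ
    have hw : ∀ w : Sp n × ℝ, z.2 - 1 ^ 2 ≤ w.2 → S ≤ w.2 := fun w h => by linarith
    have hEm : ∀ w : Sp n × ℝ, S ≤ w.2 → jetEnergy (m + 1) u w ≤ η := fun w h => by
      have h2 := hS w h (m + 1) (by lia) le_rfl
      have h3 := jetSize_nonneg (m + 1) u w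
      exact (jetEnergy_le_sq (m + 1)).trans (by nlinarith)
    have hb := bernstein_estimate (smoothPos_jetEnergy hu.smooth (m + 1))
      (smoothPos_jetEnergy hu.smooth (m + 2)) (h := jetEnergy (m + 3) u) (z₀ := z) (r := 1)
      (K := D) (S := η) (B₀ := 2 * C * η) (B₁ := D * η) one_pos (by linarith) hD0 (by positivity)
      (by positivity) (jetEnergy_nonneg _ u) (jetEnergy_nonneg _ u) (jetEnergy_nonneg _ u)
      (fun w _ h2 _ => hEm w (hw w h2))
      (fun w h => sum_sq_dirDeriv_jetEnergy_le hu.smooth (m + 2) h)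
      (fun w _ h2 _ => by
        have hSw := hw w h2.le
        have := hC u hu w (by linarith) η hη0.le hη1 fun j h3 h4 => hS w hSw j h3 (by lia)
        have h5 := mul_le_mul_of_nonneg_left (hEm w hSw) hC0
        linarith)
      (fun w _ h2 _ => by
        have hSw := hw w h2.le
        have := hD u hu w (by linarith) η hη0.le hη1 fun j h3 h4 => hS w hSw j h3 (by lia)
        simpa using this)
    refine le_of_sq_le_sq ?_ hδ.le
    calc jetSize (m + 2) u z ^ 2 ≤ k * n ^ (m + 2) * jetEnergy (m + 2) u z := jetSize_sq_le (m + 2)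
      _ ≤ k * n ^ (m + 2) * (A * η) := by
          gcongr
          refine hb.trans (le_of_eq ?_)
          rw [hA]; ring
      _ = G * η := by rw [hG]; ring
      _ ≤ δ ^ 2 := hηG

end Convergence

section Slices

variable {n k : ℕ} {u : Sp n × ℝ → Fin k → ℝ}

open scoped ContDiff in
theorem SmoothPos.contDiff_slice {f : Sp n × ℝ → ℝ} (hf : SmoothPos f) {t : ℝ} (ht : 0 < t) :
    ContDiff ℝ ∞ (fun y : Sp n => f (y, t)) :=
  contDiff_iff_contDiffAt.mpr fun x =>
    (hf.contDiffAt (z := (x, t)) ht).comp x (contDiffAt_id.prodMk contDiffAt_const)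

theorem norm_iteratedFDeriv_sum_smul_le {E F ι : Type*} [NormedAddCommGroup E] [NormedSpace ℝ E]
    [NormedAddCommGroup F] [NormedSpace ℝ F] [Fintype ι] {m : ℕ} {g : ι → E → ℝ}
    (hg : ∀ i, ContDiff ℝ m (g i)) {a : ι → F} (ha : ∀ i, ‖a i‖ ≤ 1) (x : E) :
    ‖iteratedFDeriv ℝ m (fun y => ∑ i, g i y • a i) x‖ ≤ ∑ i, ‖iteratedFDeriv ℝ m (g i) x‖ := by
  rw [iteratedFDeriv_fun_sum_apply (f := fun i y => g i y • a i) fun i _ => ((hg i).smul contDiff_const).contDiffAt]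
  refine (norm_sum_le _ _).trans (Finset.sum_le_sum fun i _ => ?_)
  have := (ContinuousLinearMap.toSpanSingleton ℝ (a i)).norm_iteratedFDeriv_comp_left
    (hg i).contDiffAt (x := x) le_rfl
  rw [ContinuousLinearMap.norm_toSpanSingleton] at this
  exact this.trans (mul_le_of_le_one_left (norm_nonneg _) (ha i))

theorem norm_iteratedFDeriv_slice_le {t : ℝ} (ht : 0 < t) (x : Sp n) (m : ℕ) :
    ∀ {f : Sp n × ℝ → ℝ}, SmoothPos f →
      ‖iteratedFDeriv ℝ m (fun y : Sp n => f (y, t)) x‖ ≤ jetNorm m f (x, t) := by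
  induction m with
  | zero => intro f _; simp [jetNorm]
  | succ m ih =>
    intro f hf
    have hfd : fderiv ℝ (fun y : Sp n => f (y, t)) = fun y => ∑ α : Fin n,
        dirDeriv (sdir n α) f (y, t) • (EuclideanSpace.proj α : Sp n →L[ℝ] ℝ) := by
      funext y
      rw [(hf.hasFDerivAt_slice ht).fderiv]
      ext v
      simp [fderiv_prod_zero_eq_sum, mul_comm]
    have hproj : ∀ α : Fin n, ‖(EuclideanSpace.proj α : Sp n →L[ℝ] ℝ)‖ ≤ 1 := fun α =>
      ContinuousLinearMap.opNorm_le_bound _ zero_le_one fun v => by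
        simpa using PiLp.norm_apply_le v α
    rw [← norm_iteratedFDeriv_fderiv, hfd]
    refine (norm_iteratedFDeriv_sum_smul_le (fun α =>
      ((hf.dirDeriv _).contDiff_slice ht).of_le (by exact_mod_cast le_top)) hproj x).trans ?_
    exact Finset.sum_le_sum fun α _ => ih (hf.dirDeriv _)

theorem norm_iteratedFDeriv_slice_le_jetSize (hu : ∀ i, SmoothPos (fun z => u z i)) {t : ℝ}
    (ht : 0 < t) (x : Sp n) (m : ℕ) :
    ‖iteratedFDeriv ℝ m (fun y : Sp n => u (y, t)) x‖ ≤ jetSize m u (x, t) := by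
  have hsum : (fun y : Sp n => u (y, t)) =
      fun y => ∑ i, u (y, t) i • (Pi.single i 1 : Fin k → ℝ) := by
    ext y j
    simp [Finset.sum_apply, Pi.single_apply]
  have hsingle : ∀ i : Fin k, ‖(Pi.single i 1 : Fin k → ℝ)‖ ≤ 1 := fun i => by
    rw [Pi.norm_single, norm_one]
  have hg : ∀ i, ContDiff ℝ m (fun y : Sp n => u (y, t) i) := fun i =>
    ((hu i).contDiff_slice ht).of_le (by exact_mod_cast le_top)
  have hle : ∀ i, ‖iteratedFDeriv ℝ m (fun y : Sp n => u (y, t) i) x‖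
      ≤ jetNorm m (fun w => u w i) (x, t) := fun i =>
    norm_iteratedFDeriv_slice_le ht x m (f := fun w => u w i) (hu i)
  rw [hsum]
  refine (norm_iteratedFDeriv_sum_smul_le hg hsingle x).trans ?_
  exact Finset.sum_le_sum fun i _ => hle i

end Slices

section Limit

variable {n k : ℕ} {u : Sp n × ℝ → Fin k → ℝ}

open scoped ContDiff in
theorem SphereFlow.of_heatFlow (hs : SphereValued u {z : Sp n × ℝ | 0 ≤ z.2})
    (hd : ContDiffOn ℝ ∞ u {z : Sp n × ℝ | 0 < z.2}) (hf : HeatFlow u {z : Sp n × ℝ | 0 < z.2}) :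
    SphereFlow u where
  smooth := contDiffOn_pi.mp hd
  sphere z hz := hs z (le_of_lt hz)
  flow z hz i := by
    rw [heatOp, sub_eq_iff_eq_add']
    exact hf z hz i

/-- If the spatial derivatives decay uniformly and the flow converges at the origin, it converges
locally smoothly to the constant limit. -/
theorem SphereFlow.tendstoUniformlyOn_const (hu : SphereFlow u)
    (hj : ∀ m : ℕ, ∀ δ > 0, ∃ T : ℝ, 1 ≤ T ∧ ∀ z : Sp n × ℝ, T ≤ z.2 →
      ∀ j, 1 ≤ j → j ≤ m + 1 → jetSize j u z ≤ δ)
    {c : Fin k → ℝ} (hc : Tendsto (fun t => u (0, t)) atTop (nhds c)) {K : Set (Sp n)}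
    (hK : IsCompact K) (m : ℕ) :
    TendstoUniformlyOn (fun (t : ℝ) (x : Sp n) => iteratedFDeriv ℝ m (fun y => u (y, t)) x)
      (fun x => iteratedFDeriv ℝ m (fun _ : Sp n => c) x) atTop K := by
  rw [Metric.tendstoUniformlyOn_iff]
  intro ε hε
  rcases m with _ | m
  · obtain ⟨ρ, hρ⟩ := hK.isBounded.subset_closedBall (0 : Sp n)
    obtain ⟨T, hT1, hT⟩ := hj 0 (ε / (2 * (|ρ| + 1))) (by positivity)
    filter_upwards [(Metric.tendsto_nhds.mp hc) (ε / 2) (by positivity), eventually_ge_atTop T]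
      with t ht htT x hx
    have ht0 : 0 < t := by linarith
    have hx0 : dist x 0 ≤ |ρ| := (mem_closedBall.mp (hρ hx)).trans (le_abs_self ρ)
    have hcomp : ∀ i, |u (x, t) i - u (0, t) i| ≤ ε / 2 := fun i => by
      have := (hu.smooth i).abs_sub_le (x₀ := 0) (x := x) (y := 0) (r := |ρ|) (s := t)
        (L := ε / (2 * (|ρ| + 1))) ht0 (by positivity) (fun y _ => ?_) hx0 (by simp)
      · refine this.trans ?_
        calc ε / (2 * (|ρ| + 1)) * dist x 0 ≤ ε / (2 * (|ρ| + 1)) * (|ρ| + 1) := by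
              gcongr; linarith
          _ = ε / 2 := by field_simp
      · have h1 := hT (y, t) htT 1 le_rfl le_rfl
        calc ∑ α, dirDeriv (sdir n α) (fun z => u z i) (y, t) ^ 2 ≤ gradSq u (y, t) :=
              Finset.sum_le_sum fun α _ => Finset.single_le_sum
                (f := fun i => pd u i (sdir n α) (y, t) ^ 2) (fun _ _ => sq_nonneg _)
                (Finset.mem_univ i)
          _ ≤ jetSize 1 u (y, t) ^ 2 := by
              rw [gradSq_eq_jetEnergy]; exact jetEnergy_le_sq 1
          _ ≤ _ := pow_le_pow_left₀ (jetSize_nonneg _ _ _) h1 2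
    have hdist : dist (u (x, t)) (u (0, t)) ≤ ε / 2 :=
      (dist_pi_le_iff (by positivity)).mpr fun i => by rw [Real.dist_eq]; exact hcomp i
    simp only [iteratedFDeriv_zero_eq_comp, Function.comp_apply, LinearIsometryEquiv.dist_map]
    calc dist c (u (x, t)) ≤ dist c (u (0, t)) + dist (u (0, t)) (u (x, t)) := dist_triangle _ _ _
      _ < ε / 2 + ε / 2 := by
          rw [dist_comm c, dist_comm (u (0, t)) (u (x, t))]
          exact add_lt_add_of_lt_of_le ht hdist
      _ = ε := by ring
  · obtain ⟨T, hT1, hT⟩ := hj m (ε / 2) (by positivity)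
    filter_upwards [eventually_ge_atTop T] with t htT x _
    have ht0 : 0 < t := by linarith
    rw [iteratedFDeriv_const_of_ne (Nat.succ_ne_zero m), Pi.zero_apply, dist_zero_left]
    have h1 := norm_iteratedFDeriv_slice_le_jetSize hu.smooth ht0 x (m + 1)
    have h2 := hT (x, t) htT (m + 1) (by lia) le_rfl
    linarith

end Limit

/-- Corollary 1.4 of the paper (case M = ℝⁿ, N = S^{k-1}): unique limit at time infinity for
the harmonic map heat flow with small renormalized energy. -/
theorem unique_limit_heat_flow_sphere_small_morrey
    (n k : ℕ) (hn : 2 ≤ n) (hk : 2 ≤ k) (p : ℝ) (hp1 : 1 < p) (hp2 : p ≤ 2) :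
    ∃ ε₀ R₀ : ℝ, 0 < ε₀ ∧ 0 < R₀ ∧
      ∀ u : Sp n × ℝ → Fin k → ℝ,
        ContinuousOn u {z : Sp n × ℝ | 0 ≤ z.2} →
        SphereValued u {z : Sp n × ℝ | 0 ≤ z.2} →
        ContDiffOn ℝ (⊤ : ℕ∞) u {z : Sp n × ℝ | 0 < z.2} →
        HeatFlow u {z : Sp n × ℝ | 0 < z.2} →
        IntegrableOn (fun z => gradSq u z + dtSq u z) {z : Sp n × ℝ | 0 < z.2} →
        MorreySmall u p R₀ ε₀ →
        ∃ uinf : Sp n → Fin k → ℝ,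
          ContDiff ℝ (⊤ : ℕ∞) uinf ∧
          (∀ x : Sp n, ∑ i : Fin k, (uinf x i) ^ 2 = 1) ∧
          (∀ (x : Sp n) (i : Fin k), lapSp uinf i x + gradSqSp uinf x * uinf x i = 0) ∧
          Integrable (fun x => gradSqSp uinf x) ∧
          Tendsto
            (fun t => ∫ x : Sp n, ∑ α : Fin n, ∑ i : Fin k,
              (pd u i (sdir n α) (x, t) - spd uinf i α x) ^ 2) atTop (nhds 0) ∧
          ∀ K : Set (Sp n), IsCompact K → ∀ m : ℕ,
            TendstoUniformlyOn
              (fun (t : ℝ) (x : Sp n) => iteratedFDeriv ℝ m (fun y => u (y, t)) x)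
              (fun x => iteratedFDeriv ℝ m uinf x) atTop K := by
  obtain ⟨C, hC1, hC⟩ := exists_gradSq_le_integral_of_morreySmall n k
  refine ⟨1 / (2 * C ^ 2), 1, by positivity, one_pos, fun u _ hs hd hf hint hM => ?_⟩
  have hu := SphereFlow.of_heatFlow hs hd hf
  have he : IntegrableOn (gradSq u) {z : Sp n × ℝ | 0 < z.2} := by
    refine Integrable.mono' hint (measurable_gradSq u).aestronglyMeasurable (ae_of_all _ fun z => ?_)
    rw [Real.norm_of_nonneg (gradSq_nonneg u z)]
    exact le_add_of_nonneg_right (Finset.sum_nonneg fun _ _ => sq_nonneg _)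
  obtain ⟨T, hT, hb⟩ := hC u hu he p hp1.le hp2 hM
  obtain ⟨M, hM0, hM⟩ := exists_gradSq_le_div_sq hn he hC1 hT hb
  obtain ⟨M', hM'0, hM'⟩ := hu.exists_jetEnergy_two_le_div_cube hM0 hT hM
  choose c hc using hu.exists_tendsto (T := 2 * T) hM0 hM'0 (by linarith)
    (fun z hz => hM z (by linarith)) hM' 0
  have hc' : Tendsto (fun t => u (0, t)) atTop (nhds c) := tendsto_pi_nhds.mpr hc
  have hc1 : ∑ i, c i ^ 2 = 1 := by
    refine tendsto_nhds_unique (tendsto_finsetSum _ fun i _ => (hc i).pow 2)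
      (tendsto_const_nhds.congr' ?_)
    filter_upwards [eventually_gt_atTop 0] with t ht
    exact (hu.sphere (0, t) ht).symm
  have hspd : ∀ i α x, spd (fun _ : Sp n => c) i α x = 0 := fun i α x => by simp [spd]
  have hgr : ∀ x, gradSqSp (fun _ : Sp n => c) x = 0 := fun x => by simp [gradSqSp, hspd]
  refine ⟨fun _ => c, contDiff_const, fun _ => hc1, fun x i => ?_, ?_, ?_, fun K hK m =>
    hu.tendstoUniformlyOn_const (hu.exists_jetSize_le (by linarith) hM) hc' hK m⟩
  · have : ∀ α, spd (fun _ : Sp n => c) i α = fun _ => 0 := fun α => funext (hspd i α)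
    simp [hgr, lapSp, this]
  · simp [hgr]
  · have hlim : Tendsto (fun t => C * (ballVol n * tailEnergy u (t - 1))) atTop (nhds 0) := by
      have := ((tendsto_tailEnergy he).comp
        (tendsto_atTop_add_const_right atTop (-1) tendsto_id)).const_mul (ballVol n) |>.const_mul C
      simpa [Function.comp_def, sub_eq_add_neg] using this
    refine squeeze_zero' (Eventually.of_forall fun t => integral_nonneg fun x =>
      Finset.sum_nonneg fun _ _ => Finset.sum_nonneg fun _ _ => sq_nonneg _) ?_ hlim
    filter_upwards [eventually_ge_atTop T] with t ht
    simp only [hspd, sub_zero]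
    refine integral_slice_le_tailEnergy he (by linarith) (by linarith) fun x => ?_
    simpa using hb (x, t) ht 1 one_pos (by linarith)
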